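/- arXiv:1306.2079 — 2 statements merged into one kernel-verified Lean document; each statement's English description precedes it below -/
import Mathlib

section
/- Let (G, L) be an instance of MLCM with no unavoidable crossings in which no line is a subpath of another and every overlapping pair of lines has a separator. For each edge e, define the directed relation graph G_e whose vertices are the lines L_e through e, with an arc (l1, l2) whenever l1 and l2 split in such a way that l1 must be above l2 on e in every crossing-free solution. Then every relation graph G_e is acyclic. -/
/-!
Core model for metro-line crossing minimization (MLCM).

An embedded graph is a symmetric loopless graph together with, for each
vertex, a list of its neighbours in clockwise order (the embedding).
A line is a simple path in the graph.  A line layout assigns to each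
ordered pair `(u, v)` forming an edge the clockwise order `ord u v` in
which the lines through `{u, v}` meet the port of `u`.
-/

structure EmbeddedGraph (V : Type) where
  adj : V → V → Prop
  symm : ∀ {u v}, adj u v → adj v u
  loopless : ∀ v, ¬ adj v v
  rot : V → List V
  rot_mem : ∀ u v, v ∈ rot u ↔ adj u v
  rot_nodup : ∀ u, (rot u).Nodup

/-- `p` is a simple path (with at least one edge) in `G`. -/
def EmbeddedGraph.IsPath {V : Type} (G : EmbeddedGraph V) (p : List V) : Prop :=
  p.Nodup ∧ 2 ≤ p.length ∧ p.Chain' G.adj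

/-- An instance of MLCM: an embedded graph together with a set of lines
(indexed by `ι`), each a simple path. -/
structure MLCMInstance (V ι : Type) where
  G : EmbeddedGraph V
  line : ι → List V
  line_path : ∀ i, G.IsPath (line i)

namespace MLCMInstance

variable {V ι : Type}

/-- Line `i` passes through the edge `{u, v}`. -/
def usesEdge (M : MLCMInstance V ι) (i : ι) (u v : V) : Prop :=
  [u, v] <:+: M.line i ∨ [v, u] <:+: M.line i

/-- `u` is a terminal (an endpoint) of line `i`. -/
def Terminal (M : MLCMInstance V ι) (i : ι) (u : V) : Prop :=
  (M.line i).head? = some u ∨ (M.line i).getLast? = some u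

/-- A line layout: for each ordered pair `(u, v)`, the clockwise order
(at the port of `u`) of the lines through the edge `{u, v}`. -/
structure Layout (M : MLCMInstance V ι) where
  ord : V → V → List ι
  nodup : ∀ u v, (ord u v).Nodup
  mem_iff : ∀ u v i, i ∈ ord u v ↔ M.usesEdge i u v

variable {M : MLCMInstance V ι}

/-- Lines `i` and `j` have an edge crossing on the edge `{u, v}`:
they appear in the same relative order in both port orders. -/
def EdgeCross (lay : M.Layout) (i j : ι) (u v : V) : Prop :=
  i ≠ j ∧ List.Sublist [i, j] (lay.ord u v) ∧ List.Sublist [i, j] (lay.ord v u)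

/-- The cyclic concatenation of the port orders at `u`, following the
clockwise order of the edges incident to `u`. -/
def cyclicAt (lay : M.Layout) (u : V) : List ι :=
  (M.G.rot u).flatMap fun w => lay.ord u w

/-- Lines `i` and `j` have a vertex crossing at `u`: they alternate
`… i … j … i … j …` in the cyclic concatenation of the port orders. -/
def VertexCross (lay : M.Layout) (i j : ι) (u : V) : Prop :=
  i ≠ j ∧ ∃ n, List.Sublist [i, j, i, j] ((cyclicAt lay u).rotate n)

/-- Lines `i` and `j` cross in the layout. -/
def Crosses (lay : M.Layout) (i j : ι) : Prop :=
  (∃ u v, EdgeCross lay i j u v ∨ EdgeCross lay j i u v) ∨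
  (∃ u, VertexCross lay i j u ∨ VertexCross lay j i u)

/-- The pair of lines `i, j` has an unavoidable crossing: the lines
cross in every line layout. -/
def Unavoidable (M : MLCMInstance V ι) (i j : ι) : Prop :=
  ∀ lay : M.Layout, Crosses lay i j

/-- A vertex crossing of `i, j` at `u` is unavoidable: it occurs in
every line layout. -/
def UnavoidableVC (M : MLCMInstance V ι) (i j : ι) (u : V) : Prop :=
  ∀ lay : M.Layout, VertexCross lay i j u ∨ VertexCross lay j i u

/-- A layout is feasible when it contains no avoidable vertex crossings. -/
def Feasible (lay : M.Layout) : Prop :=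
  ∀ i j u, VertexCross lay i j u → M.UnavoidableVC i j u

/-- A layout is crossing-free when no two lines cross in it. -/
def CrossingFree (lay : M.Layout) : Prop :=
  ∀ i j, i ≠ j → ¬ Crosses lay i j

/-- The periphery condition: at every port the lines terminating at that
vertex occupy the outermost positions of the port order. -/
def Periphery (lay : M.Layout) : Prop :=
  ∀ u v, ∃ s₁ s₂ s₃ : List ι, lay.ord u v = s₁ ++ s₂ ++ s₃ ∧
    (∀ i ∈ s₁, M.Terminal i u) ∧ (∀ i ∈ s₂, ¬ M.Terminal i u) ∧
    (∀ i ∈ s₃, M.Terminal i u)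

/-- `P` occurs as a (contiguous) subpath of line `i` (in either direction). -/
def InfixOf (M : MLCMInstance V ι) (i : ι) (P : List V) : Prop :=
  P <:+: M.line i ∨ P.reverse <:+: M.line i

/-- `P` is a common subpath (with at least one edge) of lines `i` and `j`. -/
def CommonSubpath (M : MLCMInstance V ι) (i j : ι) (P : List V) : Prop :=
  2 ≤ P.length ∧ M.InfixOf i P ∧ M.InfixOf j P

/-- `P` is the (maximal) common subpath of lines `i` and `j`. -/
def MaxCommonSubpath (M : MLCMInstance V ι) (i j : ι) (P : List V) : Prop :=
  M.CommonSubpath i j P ∧ ∀ Q, M.CommonSubpath i j Q → Q.length ≤ P.length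

/-- No line is a subpath of another line. -/
def ProperLines (M : MLCMInstance V ι) : Prop :=
  ∀ i j, i ≠ j → ¬ M.InfixOf j (M.line i)

/-- Relative to the edge directed from `u` to `v`: line `i` is above
line `j` in every crossing-free solution. -/
def MustAbove (M : MLCMInstance V ι) (i j : ι) (u v : V) : Prop :=
  ∀ lay : M.Layout, Feasible lay → CrossingFree lay → List.Sublist [i, j] (lay.ord u v)

/-- `i, j` is an overlapping pair with common subpath `P` from `u` to `v`:
`i` has its terminal at `u`, and `j` has its terminal at `v`. -/
def OverlappingPair (M : MLCMInstance V ι) (i j : ι) (P : List V) (u v : V) : Prop :=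
  i ≠ j ∧ M.MaxCommonSubpath i j P ∧ P.head? = some u ∧ P.getLast? = some v ∧
    M.Terminal i u ∧ M.Terminal j v ∧ ¬ M.Terminal i v ∧ ¬ M.Terminal j u

/-- `l` is a separator of the overlapping pair `i, j` with common subpath `P`:
on `P`, in every crossing-free solution, `l` lies between `i` and `j`. -/
def Separator (M : MLCMInstance V ι) (i j : ι) (P : List V) (l : ι) : Prop :=
  l ≠ i ∧ l ≠ j ∧ ∃ u v, [u, v] <:+: P ∧
    ((M.MustAbove i l u v ∧ M.MustAbove l j u v) ∨
     (M.MustAbove j l u v ∧ M.MustAbove l i u v))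

end MLCMInstance

namespace MLCMInstance

variable {V ι : Type}

/-- Lines `i` and `j` split: they share an edge `{a, w}` and continue from `w`
on two different edges (so neither of them terminates at `w`). -/
def Splits (M : MLCMInstance V ι) (i j : ι) : Prop :=
  ∃ a w bi bj : V, bi ≠ bj ∧ M.InfixOf i [a, w, bi] ∧ M.InfixOf j [a, w, bj]

/-- The arc `(i, j)` of the relation graph `G_e` of the edge `e = (u, v)`:
both lines pass through `e`, and they split in such a way that `i` has to be
above `j` on `e` in every crossing-free solution. -/
def RelArc (M : MLCMInstance V ι) (u v : V) (i j : ι) : Prop :=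
  i ≠ j ∧ M.usesEdge i u v ∧ M.usesEdge j u v ∧ M.Splits i j ∧ M.MustAbove i j u v

end MLCMInstance

/-- How the continuations of a family of lines behave beyond one end of an edge: `A i j` says that
`i` and `j` split with `i` above, `N i j` that the continuation of `j` is an initial part of that
of `i`. -/
structure Side {X : Type} (A N : X → X → Prop) : Prop where
  tri : ∀ i j, A i j ∨ A j i ∨ N i j ∨ N j i
  asymm : ∀ i j, A i j → ¬ A j i
  not_nested : ∀ i j, A i j → ¬ N i j
  not_nested' : ∀ i j, A i j → ¬ N j i
  mono_left : ∀ a b c, A a b → N c a → A c b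
  mono_right : ∀ a b c, A a b → N c b → A a c
  trans : ∀ a b c, A a b → A b c → A a c
  refl : ∀ a, N a a
  ntrans : ∀ a b c, N a b → N b c → N a c
  laminar : ∀ a b c, N a b → N a c → N b c ∨ N c b

/-- The continuations of a family of lines beyond both ends of a common edge. -/
structure TwoSided {X : Type} (A₁ N₁ A₂ N₂ : X → X → Prop) : Prop where
  side₁ : Side A₁ N₁
  side₂ : Side A₂ N₂
  consistent : ∀ i j, A₁ i j → ¬ A₂ j i
  proper : ∀ i j, N₁ i j → N₂ i j → i = j

namespace TwoSided

variable {X : Type} {A₁ N₁ A₂ N₂ : X → X → Prop}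

/-- A split at one of the two ends puts `i` above `j`. -/
def Det (A₁ A₂ : X → X → Prop) (i j : X) : Prop := A₁ i j ∨ A₂ i j

/-- At most two splits put `i` above `j`. -/
def Forced (A₁ A₂ : X → X → Prop) (i j : X) : Prop :=
  Det A₁ A₂ i j ∨ ∃ k, Det A₁ A₂ i k ∧ Det A₁ A₂ k j

/-- `i` is put above `j`, by splits if these decide and otherwise because `i` ends first beyond the
first end. -/
def Above (A₁ N₁ A₂ N₂ : X → X → Prop) (i j : X) : Prop :=
  Forced A₁ A₂ i j ∨ (i ≠ j ∧ ¬ Forced A₁ A₂ j i ∧ N₁ j i ∧ N₂ i j)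

theorem det_asymm (h : TwoSided A₁ N₁ A₂ N₂) {a b} (hab : Det A₁ A₂ a b) : ¬ Det A₁ A₂ b a := by
  have := h.consistent a b
  have := h.consistent b a
  have := h.side₁.asymm a b
  have := h.side₂.asymm a b
  unfold Det at *
  tauto

theorem not_cycle_three (h : TwoSided A₁ N₁ A₂ N₂) {a b c} (hab : Det A₁ A₂ a b)
    (hbc : Det A₁ A₂ b c) : ¬ Det A₁ A₂ c a := by
  intro hca
  have := h.det_asymm hab
  have := h.det_asymm hbc
  have := h.det_asymm hca
  obtain ⟨⟨t1, t2, t3, t4, t5, t6, t7, t8, t9, t10⟩,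
    ⟨s1, s2, s3, s4, s5, s6, s7, s8, s9, s10⟩, h3, h4⟩ := h
  unfold Det at *
  grind

/-- A line between two lines that do not split separates an overlapping pair and splits
from one of the two at each end. -/
theorem separator_side (h : TwoSided A₁ N₁ A₂ N₂) {a b c} (hab : Det A₁ A₂ a b)
    (hbc : Det A₁ A₂ b c) (hac : ¬ Det A₁ A₂ a c) :
    (N₁ c a ∧ N₂ a c ∧ A₂ a b ∧ A₁ b c ∧ N₁ b a ∧ N₂ b c) ∨
      (N₁ a c ∧ N₂ c a ∧ A₁ a b ∧ A₂ b c ∧ N₂ b a ∧ N₁ b c) := by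
  have h0 := h.not_cycle_three hab hbc
  have := h.det_asymm hab
  have := h.det_asymm hbc
  obtain ⟨⟨t1, t2, t3, t4, t5, t6, t7, t8, t9, t10⟩,
    ⟨s1, s2, s3, s4, s5, s6, s7, s8, s9, s10⟩, h3, h4⟩ := h
  unfold Det at *
  rcases hab with hab | hab <;> rcases hbc with hbc | hbc <;> grind (splits := 30)

theorem det_three (h : TwoSided A₁ N₁ A₂ N₂) {a b c d} (hab : Det A₁ A₂ a b)
    (hbc : Det A₁ A₂ b c) (hcd : Det A₁ A₂ c d) : Forced A₁ A₂ a d := by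
  by_cases hac : Det A₁ A₂ a c
  · exact Or.inr ⟨c, hac, hcd⟩
  by_cases hbd : Det A₁ A₂ b d
  · exact Or.inr ⟨b, hab, hbd⟩
  exfalso
  have h1 := h.separator_side hab hbc hac
  have h2 := h.separator_side hbc hcd hbd
  have n1 := h.side₁.not_nested
  have n2 := h.side₁.not_nested'
  have m1 := h.side₂.not_nested
  have m2 := h.side₂.not_nested'
  have r2 := h.side₂.mono_right
  have r1 := h.side₁.mono_right
  grind

theorem forced_trans (h : TwoSided A₁ N₁ A₂ N₂) {a b c} (hab : Forced A₁ A₂ a b)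
    (hbc : Forced A₁ A₂ b c) : Forced A₁ A₂ a c := by
  have key : ∀ {a b c}, Forced A₁ A₂ a b → Det A₁ A₂ b c → Forced A₁ A₂ a c := by
    rintro a b c (h1 | ⟨k, h1, h2⟩) h3
    · exact Or.inr ⟨b, h1, h3⟩
    · exact h.det_three h1 h2 h3
  rcases hbc with h1 | ⟨k, h1, h2⟩
  · exact key hab h1
  · exact key (key hab h1) h2

theorem forced_irrefl (h : TwoSided A₁ N₁ A₂ N₂) (a : X) : ¬ Forced A₁ A₂ a a := by
  rintro (h1 | ⟨k, h1, h2⟩)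
  · exact h.det_asymm h1 h1
  · exact h.det_asymm h1 h2

theorem above_asymm (h : TwoSided A₁ N₁ A₂ N₂) {a b} (hab : Above A₁ N₁ A₂ N₂ a b) :
    ¬ Above A₁ N₁ A₂ N₂ b a := by
  have h1 := h.forced_irrefl
  have h2 : Forced A₁ A₂ a b → Forced A₁ A₂ b a → Forced A₁ A₂ a a := h.forced_trans
  have h3 := h.proper a b
  unfold Above at *
  grind

theorem above_total (h : TwoSided A₁ N₁ A₂ N₂) {a b} (hab : a ≠ b) :
    Above A₁ N₁ A₂ N₂ a b ∨ Above A₁ N₁ A₂ N₂ b a := by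
  have h1 := h.side₁.tri a b
  have h2 := h.side₂.tri a b
  have h3 := h.proper a b
  have h4 := h.proper b a
  unfold Above
  by_cases f1 : Forced A₁ A₂ a b
  · tauto
  by_cases f2 : Forced A₁ A₂ b a
  · tauto
  have : ¬ Det A₁ A₂ a b := fun h => f1 (Or.inl h)
  have : ¬ Det A₁ A₂ b a := fun h => f2 (Or.inl h)
  unfold Det at *
  grind

theorem default_trans (h : TwoSided A₁ N₁ A₂ N₂) {a b c} (hab : ¬ Forced A₁ A₂ b a)
    (hbc : ¬ Forced A₁ A₂ c b) (n₁ : N₁ b a) (n₂ : N₂ a b) (m₁ : N₁ c b) (m₂ : N₂ b c) :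
    ¬ Forced A₁ A₂ c a := by
  have q1 := h.side₁.ntrans _ _ _ m₁ n₁
  have q2 := h.side₂.ntrans _ _ _ n₂ m₂
  rintro (hd | ⟨s, h1, h2⟩)
  · rcases hd with hd | hd
    · exact h.side₁.not_nested _ _ hd q1
    · exact h.side₂.not_nested' _ _ hd q2
  have hca : ¬ Det A₁ A₂ c a := by
    rintro (hd | hd)
    · exact h.side₁.not_nested _ _ hd q1
    · exact h.side₂.not_nested' _ _ hd q2
  have h3 := h.separator_side h1 h2 hca
  have f1 : ¬ Det A₁ A₂ b s := fun hd => hab (Or.inr ⟨s, hd, h2⟩)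
  have f2 : ¬ Det A₁ A₂ s b := fun hd => hbc (Or.inr ⟨s, h1, hd⟩)
  have f3 : ¬ Det A₁ A₂ b a := fun hd => hab (Or.inl hd)
  have f4 : ¬ Det A₁ A₂ c b := fun hd => hbc (Or.inl hd)
  obtain ⟨⟨t1, t2, t3, t4, t5, t6, t7, t8, t9, t10⟩,
    ⟨s1, s2, s3, s4, s5, s6, s7, s8, s9, s10⟩, h3, h4⟩ := h
  unfold Det at *
  grind (splits := 30)

theorem above_trans (h : TwoSided A₁ N₁ A₂ N₂) {a b c} (hab : Above A₁ N₁ A₂ N₂ a b)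
    (hbc : Above A₁ N₁ A₂ N₂ b c) : Above A₁ N₁ A₂ N₂ a c := by
  have hne : a ≠ c := by
    rintro rfl
    exact h.above_asymm hab hbc
  refine (h.above_total hne).resolve_right fun hca => ?_
  rcases hab with h1 | ⟨-, h1, n1, m1⟩ <;> rcases hbc with h2 | ⟨-, h2, n2, m2⟩ <;>
    rcases hca with h3 | ⟨-, h3, n3, m3⟩
  · exact h.forced_irrefl _ (h.forced_trans (h.forced_trans h1 h2) h3)
  · exact h3 (h.forced_trans h1 h2)
  · exact h2 (h.forced_trans h3 h1)
  · exact h.default_trans h2 h3 n2 m2 n3 m3 h1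
  · exact h1 (h.forced_trans h2 h3)
  · exact h.default_trans h3 h1 n3 m3 n1 m1 h2
  · exact h.default_trans h1 h2 n1 m1 n2 m2 h3
  · exact hne (h.proper _ _ n3 (h.side₂.ntrans _ _ _ m1 m2))

end TwoSided

section Lists
open scoped List
variable {α β : Type}

theorem List.Nodup.pair_asymm {l : List α} (h : l.Nodup) {a b : α} (hab : [a, b] <+ l) :
    ¬ [b, a] <+ l := by
  classical
  intro hba
  induction l with
  | nil => simp at hab
  | cons x l ih =>
    rw [List.nodup_cons] at h
    rcases List.cons_sublist_cons'.1 hab with h1 | ⟨rfl, h1⟩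
    · rcases List.cons_sublist_cons'.1 hba with h2 | ⟨rfl, h2⟩
      · exact ih h.2 h1 h2
      · exact h.1 (h1.subset (by simp))
    · rcases List.cons_sublist_cons'.1 hba with h2 | ⟨rfl, h2⟩
      · exact h.1 (h2.subset (by simp))
      · exact h.1 (h2.subset (by simp))

theorem List.Nodup.pair_trans {l : List α} (h : l.Nodup) {a b c : α} (hab : [a, b] <+ l)
    (hbc : [b, c] <+ l) : [a, c] <+ l := by
  induction l with
  | nil => simp at hab
  | cons x l ih =>
    rw [List.nodup_cons] at h
    rcases List.cons_sublist_cons'.1 hab with h1 | ⟨rfl, h1⟩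
    · rcases List.cons_sublist_cons'.1 hbc with h2 | ⟨rfl, h2⟩
      · exact (ih h.2 h1 h2).cons _
      · exact absurd (h1.subset (by simp)) h.1
    · rcases List.cons_sublist_cons'.1 hbc with h2 | ⟨rfl, h2⟩
      · have : c ∈ l := h2.subset (by simp)
        simpa using this
      · exact absurd (h1.subset (by simp)) h.1

theorem List.pair_total {l : List α} {a b : α} (ha : a ∈ l) (hb : b ∈ l) (hab : a ≠ b) :
    [a, b] <+ l ∨ [b, a] <+ l := by
  induction l with
  | nil => simp at ha
  | cons x l ih =>
    rcases List.mem_cons.1 ha with rfl | ha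
    · rcases List.mem_cons.1 hb with rfl | hb
      · exact absurd rfl hab
      · left; simpa using hb
    · rcases List.mem_cons.1 hb with rfl | hb
      · right; simpa [hab] using ha
      · exact (ih ha hb).imp (·.cons _) (·.cons _)

/-- The lists obtained from two duplicate-free lists by keeping `a` and `b` agree when the relative
order of `a` and `b` does. -/
theorem List.filter_pair_eq {l l' : List α} (p : α → Bool) (h : l.Nodup) (h' : l'.Nodup)
    (hmem : ∀ a, a ∈ l ↔ a ∈ l') (hord : ∀ a b, p a → p b → [a, b] <+ l' → [a, b] <+ l) :
    l.filter p = l'.filter p := by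
  refine List.Perm.eq_of_pairwise (le := fun a b => [a, b] <+ l) ?_ ?_ ?_ ?_
  · intro a b _ _ h1 h2
    exact absurd h2 (h.pair_asymm h1)
  · exact List.pairwise_iff_forall_sublist.2 fun hs => hs.trans List.filter_sublist
  · refine List.pairwise_iff_forall_sublist.2 fun {a b} hs => ?_
    have hsub : ∀ x ∈ [a, b], p x := fun x hx => (List.mem_filter.1 (hs.subset hx)).2
    exact hord a b (hsub a (by simp)) (hsub b (by simp)) (hs.trans List.filter_sublist)
  · exact ((List.perm_ext_iff_of_nodup h h').2 hmem).filter p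

theorem List.exists_sublist_rotate_iff {s l : List α} :
    (∃ n, s <+ l.rotate n) ↔ ∃ l₁ l₂, l = l₁ ++ l₂ ∧ s <+ l₂ ++ l₁ := by
  constructor
  · rintro ⟨n, h⟩
    rw [List.rotate_eq_drop_append_take_mod] at h
    exact ⟨_, _, (List.take_append_drop (n % l.length) l).symm, h⟩
  · rintro ⟨l₁, l₂, rfl, h⟩
    exact ⟨l₁.length, by rwa [List.rotate_append_length_eq]⟩

theorem List.exists_sublist_rotate_filter_iff {s l : List α} (p : α → Bool) (hs : ∀ a ∈ s, p a) :
    (∃ n, s <+ (l.filter p).rotate n) ↔ ∃ n, s <+ l.rotate n := by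
  rw [List.exists_sublist_rotate_iff, List.exists_sublist_rotate_iff]
  constructor
  · rintro ⟨l₁, l₂, h, hsub⟩
    obtain ⟨m₁, m₂, rfl, rfl, rfl⟩ := List.filter_eq_append_iff.1 h
    refine ⟨m₁, m₂, rfl, hsub.trans ?_⟩
    rw [← List.filter_append]
    exact List.filter_sublist
  · rintro ⟨l₁, l₂, rfl, hsub⟩
    refine ⟨l₁.filter p, l₂.filter p, List.filter_append .., ?_⟩
    have := hsub.filter p
    rwa [List.filter_eq_self.2 hs, List.filter_append] at this

/-- A relation that is transitive and total on a finite set is realised by listing the set. -/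
theorem List.exists_nodup_pair_sublist_imp [Finite α] (s : Set α) (r : α → α → Prop)
    (htrans : ∀ a b c, a ∈ s → b ∈ s → c ∈ s → r a b → r b c → r a c)
    (htotal : ∀ a b, a ∈ s → b ∈ s → a ≠ b → r a b ∨ r b a) :
    ∃ l : List α, l.Nodup ∧ (∀ a, a ∈ l ↔ a ∈ s) ∧ ∀ a b, [a, b] <+ l → r a b := by
  classical
  have := Fintype.ofFinite α
  let r' : s → s → Prop := fun a b => a = b ∨ r a b
  have : Std.Total r' := ⟨fun a b => by
    by_cases h : a = b
    · exact Or.inl (Or.inl h)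
    · exact (htotal a b a.2 b.2 (fun e => h (Subtype.ext e))).imp Or.inr Or.inr⟩
  have : IsTrans s r' := ⟨by
    rintro a b c (rfl | h1) (rfl | h2)
    · exact Or.inl rfl
    · exact Or.inr h2
    · exact Or.inr h1
    · exact Or.inr (htrans _ _ _ a.2 b.2 c.2 h1 h2)⟩
  set l := (Finset.univ : Finset s).toList.insertionSort r' with hl
  have hn : l.Nodup := (List.perm_insertionSort r' _).nodup_iff.2 (Finset.nodup_toList _)
  refine ⟨l.map Subtype.val, hn.map Subtype.val_injective, fun a => ?_, fun a b hab => ?_⟩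
  · simp [hl]
  · obtain ⟨m, hm, he⟩ := List.sublist_map_iff.1 hab
    obtain ⟨x, y, rfl, rfl, rfl⟩ : ∃ x y : s, m = [x, y] ∧ a = x ∧ b = y := by
      rcases m with _ | ⟨x, _ | ⟨y, _ | ⟨z, m⟩⟩⟩ <;> simp_all
    have h1 := List.pairwise_iff_forall_sublist.1 (List.pairwise_insertionSort r' _) hm
    refine h1.resolve_left ?_
    rintro rfl
    exact absurd (hm.nodup hn) (by simp)

/-- An element occurring twice in a concatenation of duplicate-free blocks occurs in a block other
than a given one. -/
theorem List.exists_ne_of_two_le_count_flatMap [DecidableEq β] {l : List α} (hl : l.Nodup)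
    {f : α → List β} (hf : ∀ a ∈ l, (f a).Nodup) {x : β} (hx : 2 ≤ (l.flatMap f).count x) (a : α) :
    ∃ b ∈ l, b ≠ a ∧ x ∈ f b := by
  by_contra! hcon
  have hzero : ∀ m : List α, (∀ b ∈ m, x ∉ f b) → (m.flatMap f).count x = 0 := by
    intro m hm
    rw [List.count_eq_zero]
    simpa using hm
  by_cases ha : a ∈ l
  · obtain ⟨p, q, rfl⟩ := List.append_of_mem ha
    have hp : (p.flatMap f).count x = 0 := hzero p fun b hb => hcon b (by simp [hb]) (by
      rintro rfl
      simp [List.nodup_append] at hl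
      grind)
    have hq : (q.flatMap f).count x = 0 := hzero q fun b hb => hcon b (by simp [hb]) (by
      rintro rfl
      simp [List.nodup_append] at hl
      grind)
    have := List.nodup_iff_count_le_one.1 (hf a ha) x
    simp only [List.flatMap_append, List.flatMap_cons, List.count_append] at hx
    omega
  · rw [hzero l fun b hb => hcon b hb (by rintro rfl; exact ha hb)] at hx
    omega

end Lists

section Embedding
open scoped List
variable {V : Type}

namespace EmbeddedGraph

/-- Around `w`, starting after `a` and going clockwise, `x` comes before `y`. -/
def Clockwise (G : EmbeddedGraph V) (w a x y : V) : Prop :=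
  ∃ p q, G.rot w = p ++ a :: q ∧ [x, y] <+ q ++ p

theorem exists_clockwise_list (G : EmbeddedGraph V) {w a : V} (ha : G.adj w a) :
    ∃ m : List V, m.Nodup ∧ (∀ x, x ∈ m ↔ G.adj w x ∧ x ≠ a) ∧
      ∀ x y, G.Clockwise w a x y ↔ [x, y] <+ m := by
  obtain ⟨p, q, h⟩ := List.append_of_mem ((G.rot_mem w a).2 ha)
  have hn := G.rot_nodup w
  rw [h] at hn
  have hn' : (a :: (q ++ p)).Nodup := (List.perm_append_comm (l₁ := a :: q)).nodup_iff.2 hn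
  rw [List.nodup_cons] at hn'
  refine ⟨q ++ p, hn'.2, fun x => ?_, fun x y => ⟨?_, fun hs => ⟨p, q, h, hs⟩⟩⟩
  · rw [← G.rot_mem, h]
    have : x ∈ q ++ p → x ≠ a := by
      rintro hx rfl
      exact hn'.1 hx
    simp only [List.mem_append, List.mem_cons] at *
    tauto
  · rintro ⟨p', q', h', hs⟩
    have hnot : a ∉ p ∧ a ∉ q := by simpa [and_comm] using hn'.1
    obtain ⟨rfl, -, rfl⟩ := (List.append_cons_inj_of_notMem hnot.1 hnot.2).1 (h.symm.trans h')
    exact hs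

theorem Clockwise.adj {G : EmbeddedGraph V} {w a x y : V} (h : G.Clockwise w a x y) : G.adj w a := by
  obtain ⟨p, q, h, -⟩ := h
  exact (G.rot_mem w a).1 (by simp [h])

theorem Clockwise.asymm {G : EmbeddedGraph V} {w a x y : V} (h : G.Clockwise w a x y) :
    ¬ G.Clockwise w a y x := by
  obtain ⟨m, hn, -, hm⟩ := G.exists_clockwise_list h.adj
  rw [hm] at *
  exact hn.pair_asymm h

theorem Clockwise.trans {G : EmbeddedGraph V} {w a x y z : V} (h : G.Clockwise w a x y)
    (h' : G.Clockwise w a y z) : G.Clockwise w a x z := by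
  obtain ⟨m, hn, -, hm⟩ := G.exists_clockwise_list h.adj
  rw [hm] at *
  exact hn.pair_trans h h'

theorem Clockwise.ne {G : EmbeddedGraph V} {w a x y : V} (h : G.Clockwise w a x y) : x ≠ y := by
  rintro rfl
  exact h.asymm h

theorem clockwise_total {G : EmbeddedGraph V} {w a x y : V} (ha : G.adj w a) (hx : G.adj w x)
    (hy : G.adj w y) (hxa : x ≠ a) (hya : y ≠ a) (hxy : x ≠ y) :
    G.Clockwise w a x y ∨ G.Clockwise w a y x := by
  obtain ⟨m, -, hmem, hm⟩ := G.exists_clockwise_list ha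
  rw [hm, hm]
  exact List.pair_total ((hmem x).2 ⟨hx, hxa⟩) ((hmem y).2 ⟨hy, hya⟩) hxy

/-- Two continuations of the edge from `a` to `w` separate, the first one on the upper side. -/
def SplitAbove (G : EmbeddedGraph V) : V → V → List V → List V → Prop
  | _, _, [], _ => False
  | _, _, _ :: _, [] => False
  | a, w, x :: xs, y :: ys => G.Clockwise w a x y ∨ (x = y ∧ G.SplitAbove w x xs ys)

/-- A list that continues the edge from `a` to `w` along edges without turning back. -/
def Continues (G : EmbeddedGraph V) : V → V → List V → Prop
  | _, _, [] => True
  | a, w, x :: xs => x ≠ a ∧ G.adj w x ∧ G.Continues w x xs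

variable {G : EmbeddedGraph V}

theorem SplitAbove.asymm {a w : V} {xs ys : List V} (h : G.SplitAbove a w xs ys) :
    ¬ G.SplitAbove a w ys xs := by
  induction xs generalizing a w ys with
  | nil => simp [SplitAbove] at h
  | cons x xs ih =>
    cases ys with
    | nil => simp [SplitAbove] at h
    | cons y ys =>
      simp only [SplitAbove] at h ⊢
      rintro (h' | ⟨rfl, h'⟩)
      · rcases h with h | ⟨rfl, h⟩
        · exact h.asymm h'
        · exact h'.ne rfl
      · rcases h with h | ⟨-, h⟩
        · exact h.ne rfl
        · exact ih h h'

theorem SplitAbove.trans {a w : V} {xs ys zs : List V} (h : G.SplitAbove a w xs ys)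
    (h' : G.SplitAbove a w ys zs) : G.SplitAbove a w xs zs := by
  induction xs generalizing a w ys zs with
  | nil => simp [SplitAbove] at h
  | cons x xs ih =>
    cases ys with
    | nil => simp [SplitAbove] at h
    | cons y ys =>
      cases zs with
      | nil => simp [SplitAbove] at h'
      | cons z zs =>
        simp only [SplitAbove] at h h' ⊢
        rcases h with h | ⟨rfl, h⟩ <;> rcases h' with h' | ⟨rfl, h'⟩
        · exact Or.inl (h.trans h')
        · exact Or.inl h
        · exact Or.inl h'
        · exact Or.inr ⟨rfl, ih h h'⟩

theorem SplitAbove.append {a w : V} {xs ys : List V} (h : G.SplitAbove a w xs ys)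
    (s t : List V) : G.SplitAbove a w (xs ++ s) (ys ++ t) := by
  induction xs generalizing a w ys with
  | nil => simp [SplitAbove] at h
  | cons x xs ih =>
    cases ys with
    | nil => simp [SplitAbove] at h
    | cons y ys =>
      simp only [SplitAbove, List.cons_append] at h ⊢
      exact h.imp_right fun ⟨e, h⟩ => ⟨e, ih h⟩

theorem SplitAbove.not_prefix {a w : V} {xs ys : List V} (h : G.SplitAbove a w xs ys) :
    ¬ xs <+: ys := by
  rintro ⟨t, rfl⟩
  have := h.append t []
  rw [List.append_nil] at this
  exact this.asymm this

theorem SplitAbove.not_prefix' {a w : V} {xs ys : List V} (h : G.SplitAbove a w xs ys) :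
    ¬ ys <+: xs := by
  rintro ⟨t, rfl⟩
  have := h.append [] t
  rw [List.append_nil] at this
  exact this.asymm this

theorem SplitAbove.of_prefix {a w : V} {xs ys xs' ys' : List V} (h : G.SplitAbove a w xs ys)
    (hx : xs <+: xs') (hy : ys <+: ys') : G.SplitAbove a w xs' ys' := by
  obtain ⟨s, rfl⟩ := hx
  obtain ⟨t, rfl⟩ := hy
  exact h.append s t

theorem Continues.total {a w : V} {xs ys : List V} (ha : G.adj w a) (hx : G.Continues a w xs)
    (hy : G.Continues a w ys) :
    G.SplitAbove a w xs ys ∨ G.SplitAbove a w ys xs ∨ ys <+: xs ∨ xs <+: ys := by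
  induction xs generalizing a w ys with
  | nil => simp
  | cons x xs ih =>
    cases ys with
    | nil => simp
    | cons y ys =>
      simp only [Continues] at hx hy
      simp only [SplitAbove, List.cons_prefix_cons]
      by_cases hxy : x = y
      · subst hxy
        have := ih (G.symm hx.2.1) hx.2.2 hy.2.2
        tauto
      · have := clockwise_total ha hx.2.1 hy.2.1 hx.1 hy.1 hxy
        tauto

end EmbeddedGraph
end Embedding

section Lines
open scoped List
namespace MLCMInstance
variable {V ι : Type} {M : MLCMInstance V ι}

/-- Line `i`, read in one of its two directions, traverses the vertices of `l` backwards, then the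
edge from `u` to `v`, then the vertices of `r`. -/
def Through (M : MLCMInstance V ι) (i : ι) (u v : V) (l r : List V) : Prop :=
  M.line i = l.reverse ++ u :: v :: r ∨ (M.line i).reverse = l.reverse ++ u :: v :: r

theorem Through.symm {i : ι} {u v : V} {l r : List V} (h : M.Through i u v l r) :
    M.Through i v u r l := by
  rcases h with h | h
  · right; simp [h]
  · left; rw [← List.reverse_inj, h]; simp

theorem through_cons_iff {i : ι} {u v w : V} {l r : List V} :
    M.Through i u v l (w :: r) ↔ M.Through i v w (u :: l) r := by
  simp [Through]

theorem usesEdge_comm {i : ι} {u v : V} : M.usesEdge i u v ↔ M.usesEdge i v u := Or.comm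

theorem Through.usesEdge {i : ι} {u v : V} {l r : List V} (h : M.Through i u v l r) :
    M.usesEdge i u v := by
  rcases h with h | h
  · exact Or.inl ⟨l.reverse, r, by simp [h]⟩
  · refine Or.inr ⟨r.reverse, l, ?_⟩
    rw [← List.reverse_inj, h]; simp

theorem usesEdge.exists_through {i : ι} {u v : V} (h : M.usesEdge i u v) :
    ∃ p : List V × List V, M.Through i u v p.1 p.2 := by
  rcases h with ⟨s, t, h⟩ | ⟨s, t, h⟩
  · exact ⟨(s.reverse, t), Or.inl (by simp [← h])⟩
  · exact ⟨(t, s.reverse), Or.inr (by simp [← h])⟩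

open Classical in
/-- The vertices that line `i` visits after traversing the edge from `u` to `v`. -/
noncomputable def ahead (M : MLCMInstance V ι) (i : ι) (u v : V) : List V :=
  if h : ∃ p : List V × List V, M.Through i u v p.1 p.2 then h.choose.2 else []

theorem Through.exists_nodup {i : ι} {u v : V} {l r : List V} (h : M.Through i u v l r) :
    ∃ L : List V, L.Nodup ∧ (L = M.line i ∨ L.reverse = M.line i) ∧
      L = l.reverse ++ u :: v :: r := by
  have hn := (M.line_path i).1
  rcases h with h | h
  · exact ⟨_, hn, Or.inl rfl, h⟩
  · exact ⟨_, List.nodup_reverse.2 hn, Or.inr (List.reverse_reverse _), h⟩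

theorem Through.eq_of_oriented {u v : V} {L l r l' r' : List V} (hn : L.Nodup)
    (h : L = l.reverse ++ u :: v :: r) (h' : L = l'.reverse ++ u :: v :: r') : l = l' ∧ r = r' := by
  subst h
  have h1 : u ∉ l.reverse ∧ u ∉ v :: r := by
    have := (List.perm_middle.nodup_iff).1 hn
    simp only [List.nodup_cons, List.mem_append] at this
    tauto
  have := (List.append_cons_inj_of_notMem h1.1 h1.2).1 h'
  simpa using this

theorem Through.unique {i : ι} {u v : V} {l r l' r' : List V} (h : M.Through i u v l r)
    (h' : M.Through i u v l' r') : l = l' ∧ r = r' := by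
  have hn := (M.line_path i).1
  have hn' := List.nodup_reverse.2 hn
  have key : ∀ L a b a' b' : List V, L.Nodup → L = a.reverse ++ u :: v :: b →
      L.reverse = a'.reverse ++ u :: v :: b' → False := by
    intro L a b a' b' hL h1 h2
    have h3 : L = b'.reverse ++ v :: u :: a' := by rw [← List.reverse_inj, h2]; simp
    have q1 : [u, v] <+ L := h1 ▸ by simp
    have q2 : [v, u] <+ L := h3 ▸ by simp
    exact hL.pair_asymm q1 q2
  rcases h with h | h <;> rcases h' with h' | h'
  · exact Through.eq_of_oriented hn h h'
  · exact (key _ _ _ _ _ hn h h').elim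
  · exact (key _ _ _ _ _ hn h' h).elim
  · exact Through.eq_of_oriented hn' h h'

theorem Through.ahead_eq {i : ι} {u v : V} {l r : List V} (h : M.Through i u v l r) :
    M.ahead i u v = r := by
  have hex : ∃ p : List V × List V, M.Through i u v p.1 p.2 := ⟨(l, r), h⟩
  rw [ahead, dif_pos hex]
  exact (hex.choose_spec.unique h).2

theorem usesEdge.through {i : ι} {u v : V} (h : M.usesEdge i u v) :
    M.Through i u v (M.ahead i v u) (M.ahead i u v) := by
  obtain ⟨⟨l, r⟩, hp⟩ := h.exists_through
  rw [hp.ahead_eq, hp.symm.ahead_eq]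
  exact hp

theorem usesEdge.of_ahead {i : ι} {u v w : V} {r : List V} (h : M.usesEdge i u v)
    (hr : M.ahead i u v = w :: r) :
    M.usesEdge i v w ∧ M.ahead i v w = r ∧ M.ahead i w v = u :: M.ahead i v u := by
  have h1 := h.through
  rw [hr, through_cons_iff] at h1
  exact ⟨h1.usesEdge, h1.ahead_eq, h1.symm.ahead_eq⟩

theorem usesEdge.ahead_eq_cons {i : ι} {u v w : V} (h : M.usesEdge i u v) (h' : M.usesEdge i v w)
    (hne : u ≠ w) : M.ahead i u v = w :: M.ahead i v w := by
  have key : ∀ L a b c d : List V, L.Nodup → L = a.reverse ++ u :: v :: b →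
      L = c.reverse ++ v :: w :: d → b = w :: d := by
    rintro L a b c d hL rfl h2
    have hnot : v ∉ a.reverse ++ [u] ∧ v ∉ b := by
      have h3 : ((a.reverse ++ [u]) ++ v :: b).Nodup := by simpa using hL
      have := (List.perm_middle.nodup_iff).1 h3
      simp only [List.nodup_cons, List.mem_append] at this ⊢
      tauto
    have h3 : (a.reverse ++ [u]) ++ v :: b = c.reverse ++ v :: w :: d := by simpa using h2
    exact ((List.append_cons_inj_of_notMem hnot.1 hnot.2).1 h3).2.2
  have key' : ∀ L a b c d : List V, L.Nodup → L = a.reverse ++ u :: v :: b →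
      L.reverse = c.reverse ++ v :: w :: d → False := by
    intro L a b c d hL h1 h2
    have hL' : L = d.reverse ++ w :: v :: c := by rw [← List.reverse_inj, h2]; simp
    have h3 : (a.reverse ++ [u]) ++ v :: b = (d.reverse ++ [w]) ++ v :: c := by
      simpa using h1.symm.trans hL'
    have hnot : v ∉ a.reverse ++ [u] ∧ v ∉ b := by
      have h4 : ((a.reverse ++ [u]) ++ v :: b).Nodup := by simpa [h1] using hL
      have := (List.perm_middle.nodup_iff).1 h4
      simp only [List.nodup_cons, List.mem_append] at this ⊢
      tauto
    have h5 := ((List.append_cons_inj_of_notMem hnot.1 hnot.2).1 h3).1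
    have := congrArg List.getLast? h5
    simp at this
    exact hne this
  have hn := (M.line_path i).1
  have hn' := List.nodup_reverse.2 hn
  rcases h.through with h1 | h1 <;> rcases h'.through with h2 | h2
  · exact key _ _ _ _ _ hn h1 h2
  · exact (key' _ _ _ _ _ hn h1 h2).elim
  · exact (key' _ _ _ _ _ hn' h1 ((List.reverse_reverse _).trans h2)).elim
  · exact key _ _ _ _ _ hn' h1 h2

theorem usesEdge.adj {i : ι} {u v : V} (h : M.usesEdge i u v) : M.G.adj u v := by
  have hc : (M.line i).IsChain M.G.adj := (M.line_path i).2.2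
  rcases h with h | h
  · simpa using hc.infix h
  · exact M.G.symm (by simpa using hc.infix h)

theorem Through.nodup {i : ι} {u v : V} {l r : List V} (h : M.Through i u v l r) :
    (l.reverse ++ u :: v :: r).Nodup := by
  obtain ⟨L, hL, -, rfl⟩ := h.exists_nodup
  exact hL

theorem Through.continues {i : ι} {u v : V} {l r : List V} (h : M.Through i u v l r) :
    M.G.Continues u v r := by
  induction r generalizing u v l with
  | nil => trivial
  | cons w r ih =>
    have h' := through_cons_iff.1 h
    refine ⟨?_, h'.usesEdge.adj, ih h'⟩
    rintro rfl
    have := h.nodup.sublist (List.sublist_append_right _ _)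
    simp at this

theorem ProperLines.eq_of_prefix (hM : M.ProperLines) {i j : ι} {u v : V} (hi : M.usesEdge i u v)
    (hj : M.usesEdge j u v) (h : M.ahead i u v <+: M.ahead j u v)
    (h' : M.ahead i v u <+: M.ahead j v u) : i = j := by
  by_contra hne
  refine hM i j hne ?_
  obtain ⟨s, hs⟩ := h
  obtain ⟨t, ht⟩ := h'
  have hj' := hj.through
  rw [← hs, ← ht] at hj'
  have hi' := hi.through
  have key : ∀ L L' : List V, L = (M.ahead i v u).reverse ++ u :: v :: M.ahead i u v →
      L' = (M.ahead i v u ++ t).reverse ++ u :: v :: (M.ahead i u v ++ s) → L <:+: L' := by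
    rintro L L' rfl rfl
    exact ⟨t.reverse, s, by simp⟩
  rcases hi' with h1 | h1 <;> rcases hj' with h2 | h2
  · exact Or.inl (key _ _ h1 h2)
  · right
    simpa using List.reverse_infix.2 (key _ _ h1 h2)
  · exact Or.inr (key _ _ h1 h2)
  · left
    exact List.reverse_infix.1 (key _ _ h1 h2)

end MLCMInstance
end Lines

section Layouts
open scoped List
namespace MLCMInstance
variable {V ι : Type} {M : MLCMInstance V ι}

/-- The common subpath of `i` and `j` through the edge from `u` to `v` ends in a split that puts
`i` above `j`. -/
def SplitOrdered (M : MLCMInstance V ι) (u v : V) (i j : ι) : Prop :=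
  M.G.SplitAbove u v (M.ahead i u v) (M.ahead j u v) ∨
    M.G.SplitAbove v u (M.ahead j v u) (M.ahead i v u)

theorem exists_sublist_rotate_cyclicAt (lay : M.Layout) {w a : V} {p q : List V} {s : List ι}
    (h : M.G.rot w = p ++ a :: q) (hs : s <+ lay.ord w a ++ (q ++ p).flatMap (lay.ord w)) :
    ∃ n, s <+ (cyclicAt lay w).rotate n := by
  rw [List.exists_sublist_rotate_iff]
  refine ⟨p.flatMap (lay.ord w), (a :: q).flatMap (lay.ord w), ?_, ?_⟩
  · simp [cyclicAt, h]
  · simpa using hs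

theorem pair_sublist_flatMap {f : V → List ι} {l : List V} {i j : ι} {x y : V} (h : [x, y] <+ l)
    (hi : i ∈ f x) (hj : j ∈ f y) : [i, j] <+ l.flatMap f := by
  have h1 : [x, y].flatMap f <+ l.flatMap f := h.flatMap f
  refine List.Sublist.trans ?_ h1
  have : [i] ++ [j] <+ f x ++ f y :=
    (List.singleton_sublist.2 hi).append (List.singleton_sublist.2 hj)
  simpa using this

theorem vertexCross_of_clockwise (lay : M.Layout) {w a x y : V} {i j : ι} (hij : i ≠ j)
    (h : [i, j] <+ lay.ord w a) (hc : M.G.Clockwise w a x y) (hi : i ∈ lay.ord w x)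
    (hj : j ∈ lay.ord w y) : VertexCross lay i j w := by
  obtain ⟨p, q, hr, hs⟩ := hc
  exact ⟨hij, exists_sublist_rotate_cyclicAt lay hr (h.append (pair_sublist_flatMap hs hi hj))⟩

theorem vertexCross_of_same_order (lay : M.Layout) {w x y : V} {i j : ι} (hij : i ≠ j)
    (hxy : x ≠ y) (hx : M.G.adj w x) (hy : M.G.adj w y) (h : [i, j] <+ lay.ord w x)
    (h' : [i, j] <+ lay.ord w y) : VertexCross lay i j w := by
  obtain ⟨p, q, hr⟩ := List.append_of_mem ((M.G.rot_mem w x).2 hx)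
  have hmem : y ∈ q ++ p := by
    have := (M.G.rot_mem w y).2 hy
    simp only [hr, List.mem_append, List.mem_cons] at this ⊢
    have := hxy.symm
    tauto
  refine ⟨hij, exists_sublist_rotate_cyclicAt lay hr (h.append (h'.trans ?_))⟩
  exact List.sublist_flatten_of_mem (List.mem_map_of_mem hmem)

theorem Crosses.symm {lay : M.Layout} {i j : ι} (h : Crosses lay i j) : Crosses lay j i := by
  rcases h with ⟨u, v, h⟩ | ⟨u, h⟩
  · exact Or.inl ⟨u, v, h.symm⟩
  · exact Or.inr ⟨u, h.symm⟩

theorem sublist_ord_symm {lay : M.Layout} {i j : ι} (hc : ¬ Crosses lay i j) (hij : i ≠ j) {u v : V}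
    (h : [i, j] <+ lay.ord u v) : [j, i] <+ lay.ord v u := by
  have hi : i ∈ lay.ord v u :=
    (lay.mem_iff v u i).2 (usesEdge_comm.1 ((lay.mem_iff u v i).1 (h.subset (by simp))))
  have hj : j ∈ lay.ord v u :=
    (lay.mem_iff v u j).2 (usesEdge_comm.1 ((lay.mem_iff u v j).1 (h.subset (by simp))))
  exact (List.pair_total hi hj hij).resolve_left fun h' =>
    hc (Or.inl ⟨u, v, Or.inl ⟨hij, h, h'⟩⟩)

theorem sublist_ord_of_not_sublist {lay : M.Layout} {i j : ι} (hij : i ≠ j) {u v : V}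
    (hi : M.usesEdge i u v) (hj : M.usesEdge j u v) (h : ¬ [i, j] <+ lay.ord u v) :
    [j, i] <+ lay.ord u v :=
  (List.pair_total ((lay.mem_iff u v i).2 hi) ((lay.mem_iff u v j).2 hj) hij).resolve_left h

theorem sublist_ord_of_splitAbove {lay : M.Layout} {i j : ι} (hc : ¬ Crosses lay i j) (hij : i ≠ j)
    {u v : V} (hi : M.usesEdge i u v) (hj : M.usesEdge j u v)
    (h : M.G.SplitAbove u v (M.ahead i u v) (M.ahead j u v)) : [i, j] <+ lay.ord u v := by
  obtain ⟨xs, hxs⟩ : ∃ xs, M.ahead i u v = xs := ⟨_, rfl⟩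
  obtain ⟨ys, hys⟩ : ∃ ys, M.ahead j u v = ys := ⟨_, rfl⟩
  induction xs generalizing u v ys with
  | nil => simp [hxs, EmbeddedGraph.SplitAbove] at h
  | cons x xs ih =>
    cases ys with
    | nil => simp [hxs, hys, EmbeddedGraph.SplitAbove] at h
    | cons y ys =>
      obtain ⟨hi', hi'', -⟩ := hi.of_ahead hxs
      obtain ⟨hj', hj'', -⟩ := hj.of_ahead hys
      refine sublist_ord_symm (fun h => hc h.symm) hij.symm ?_
      refine sublist_ord_of_not_sublist hij (usesEdge_comm.1 hi) (usesEdge_comm.1 hj) fun hs => ?_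
      refine hc (Or.inr ⟨v, Or.inl ?_⟩)
      rw [hxs, hys] at h
      rcases h with h | ⟨rfl, h⟩
      · exact vertexCross_of_clockwise lay hij hs h ((lay.mem_iff _ _ _).2 hi')
          ((lay.mem_iff _ _ _).2 hj')
      · rw [← hi'', ← hj''] at h
        have hne : x ≠ u := by
          have := hi.through.continues
          rw [hxs] at this
          exact this.1
        exact vertexCross_of_same_order lay hij hne.symm (M.G.symm hi.adj) hi'.adj hs
          (ih hi' hj' h hi'' ys hj'')

theorem sublist_ord_of_splitOrdered {lay : M.Layout} {i j : ι} (hc : ¬ Crosses lay i j)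
    (hij : i ≠ j) {u v : V} (hi : M.usesEdge i u v) (hj : M.usesEdge j u v)
    (h : M.SplitOrdered u v i j) : [i, j] <+ lay.ord u v := by
  rcases h with h | h
  · exact sublist_ord_of_splitAbove hc hij hi hj h
  · have hc' : ¬ Crosses lay j i := fun h => hc h.symm
    exact sublist_ord_symm hc' hij.symm (sublist_ord_of_splitAbove hc' hij.symm
      (usesEdge_comm.1 hj) (usesEdge_comm.1 hi) h)

theorem splitOrdered_comm {u v : V} {i j : ι} : M.SplitOrdered u v i j ↔ M.SplitOrdered v u j i :=
  Or.comm

theorem SplitOrdered.asymm (hunav : ∀ i j : ι, i ≠ j → ¬ M.Unavoidable i j) {i j : ι} {u v : V}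
    (hi : M.usesEdge i u v) (hj : M.usesEdge j u v) (h : M.SplitOrdered u v i j) :
    ¬ M.SplitOrdered u v j i := by
  intro h'
  by_cases hij : i = j
  · subst hij
    rcases h with h | h <;> exact h.asymm h
  · obtain ⟨lay, hc⟩ := not_forall.1 (hunav i j hij)
    exact (lay.nodup u v).pair_asymm (sublist_ord_of_splitOrdered hc hij hi hj h)
      (sublist_ord_of_splitOrdered (fun h => hc h.symm) (Ne.symm hij) hj hi h')

/-- The order of `i` and `j` on the edge from `u` to `v` follows from at most two splits. -/
def ForcedAbove (M : MLCMInstance V ι) (u v : V) (i j : ι) : Prop :=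
  M.SplitOrdered u v i j ∨
    ∃ k, M.usesEdge k u v ∧ M.SplitOrdered u v i k ∧ M.SplitOrdered u v k j

/-- The order of the lines on the edge from `u` to `v`: forced pairs are ordered as they have to be,
and in any other pair the line on top is the one whose terminal lies ahead. -/
def LineAbove (M : MLCMInstance V ι) (u v : V) (i j : ι) : Prop :=
  M.ForcedAbove u v i j ∨ (i ≠ j ∧ ¬ M.ForcedAbove u v j i ∧
    M.ahead i u v <+: M.ahead j u v ∧ M.ahead j v u <+: M.ahead i v u)

/-- Above and nesting relations of the continuations beyond `v` of the lines from `u` to `v`. -/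
theorem side (M : MLCMInstance V ι) (u v : V) :
    Side (X := {i // M.usesEdge i u v})
      (fun i j => M.G.SplitAbove u v (M.ahead i u v) (M.ahead j u v))
      (fun i j => M.ahead j u v <+: M.ahead i u v) where
  tri i j := EmbeddedGraph.Continues.total (M.G.symm i.2.adj) i.2.through.continues
    j.2.through.continues
  asymm _ _ h := h.asymm
  not_nested _ _ h := h.not_prefix'
  not_nested' _ _ h := h.not_prefix
  mono_left _ _ _ h h' := h.of_prefix h' (List.prefix_refl _)
  mono_right _ _ _ h h' := h.of_prefix (List.prefix_refl _) h'
  trans _ _ _ h h' := h.trans h'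
  refl _ := List.prefix_refl _
  ntrans _ _ _ h h' := h'.trans h
  laminar _ _ _ h h' := (List.prefix_or_prefix_of_prefix h h').symm

/-- Above and nesting relations of the continuations beyond `u` of the lines from `u` to `v`. -/
theorem side_swap (M : MLCMInstance V ι) (u v : V) :
    Side (X := {i // M.usesEdge i u v})
      (fun i j => M.G.SplitAbove v u (M.ahead j v u) (M.ahead i v u))
      (fun i j => M.ahead j v u <+: M.ahead i v u) where
  tri i j := by
    have := EmbeddedGraph.Continues.total i.2.adj i.2.through.symm.continues
      j.2.through.symm.continues
    tauto
  asymm _ _ h := h.asymm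
  not_nested _ _ h := h.not_prefix
  not_nested' _ _ h := h.not_prefix'
  mono_left _ _ _ h h' := h.of_prefix (List.prefix_refl _) h'
  mono_right _ _ _ h h' := h.of_prefix h' (List.prefix_refl _)
  trans _ _ _ h h' := h'.trans h
  refl _ := List.prefix_refl _
  ntrans _ _ _ h h' := h'.trans h
  laminar _ _ _ h h' := (List.prefix_or_prefix_of_prefix h h').symm

theorem twoSided (hunav : ∀ i j : ι, i ≠ j → ¬ M.Unavoidable i j) (hproper : M.ProperLines)
    (u v : V) :
    TwoSided (X := {i // M.usesEdge i u v})
      (fun i j => M.G.SplitAbove u v (M.ahead i u v) (M.ahead j u v))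
      (fun i j => M.ahead j u v <+: M.ahead i u v)
      (fun i j => M.G.SplitAbove v u (M.ahead j v u) (M.ahead i v u))
      (fun i j => M.ahead j v u <+: M.ahead i v u) where
  side₁ := M.side u v
  side₂ := M.side_swap u v
  consistent i j h h' := SplitOrdered.asymm hunav i.2 j.2 (Or.inl h) (Or.inr h')
  proper i j h h' := Subtype.ext (hproper.eq_of_prefix j.2 i.2 h h').symm

theorem above_iff_lineAbove {u v : V} {i j : ι} (hi : M.usesEdge i u v) (hj : M.usesEdge j u v) :
    TwoSided.Above (X := {i // M.usesEdge i u v})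
      (fun i j => M.G.SplitAbove u v (M.ahead i u v) (M.ahead j u v))
      (fun i j => M.ahead j u v <+: M.ahead i u v)
      (fun i j => M.G.SplitAbove v u (M.ahead j v u) (M.ahead i v u))
      (fun i j => M.ahead j v u <+: M.ahead i v u) ⟨i, hi⟩ ⟨j, hj⟩ ↔ M.LineAbove u v i j := by
  simp only [TwoSided.Above, TwoSided.Forced, TwoSided.Det, LineAbove, ForcedAbove, SplitOrdered,
    Subtype.exists, exists_and_left, exists_prop, ne_eq, Subtype.mk.injEq]
  simp only [← and_assoc, and_comm]

theorem forcedAbove_comm {u v : V} {i j : ι} : M.ForcedAbove u v i j ↔ M.ForcedAbove v u j i := by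
  simp only [ForcedAbove, splitOrdered_comm (u := u) (v := v), usesEdge_comm (u := u) (v := v)]
  simp only [and_comm]

theorem lineAbove_comm {u v : V} {i j : ι} : M.LineAbove u v i j ↔ M.LineAbove v u j i := by
  simp only [LineAbove, forcedAbove_comm (u := u) (v := v)]
  simp only [and_comm, ne_comm]

theorem splitOrdered_step {i j : ι} {u v w : V} (hne : u ≠ w) (hi : M.usesEdge i u v)
    (hj : M.usesEdge j u v) (hi' : M.usesEdge i v w) (hj' : M.usesEdge j v w) :
    M.SplitOrdered u v i j ↔ M.SplitOrdered v w i j := by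
  have hirr : ∀ a b x, ¬ M.G.Clockwise a b x x := fun a b x h => h.ne rfl
  obtain ⟨-, -, hi₁⟩ := hi.of_ahead (hi.ahead_eq_cons hi' hne)
  obtain ⟨-, -, hj₁⟩ := hj.of_ahead (hj.ahead_eq_cons hj' hne)
  simp only [SplitOrdered, hi.ahead_eq_cons hi' hne, hj.ahead_eq_cons hj' hne, hi₁, hj₁,
    EmbeddedGraph.SplitAbove, hirr, false_or, true_and]

theorem ForcedAbove.step (hunav : ∀ i j : ι, i ≠ j → ¬ M.Unavoidable i j)
    (hproper : M.ProperLines) {i j : ι} {u v w : V} (hne : u ≠ w) (hi : M.usesEdge i u v)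
    (hj : M.usesEdge j u v) (hi' : M.usesEdge i v w) (hj' : M.usesEdge j v w)
    (h : M.ForcedAbove u v i j) : M.ForcedAbove v w i j := by
  by_cases hd : M.SplitOrdered u v i j
  · exact Or.inl ((splitOrdered_step hne hi hj hi' hj').1 hd)
  obtain ⟨k, hk, h1, h2⟩ := h.resolve_left hd
  have hk' : M.usesEdge k v w := by
    have hsep := (twoSided hunav hproper u v).separator_side (a := ⟨i, hi⟩) (b := ⟨k, hk⟩)
      (c := ⟨j, hj⟩) h1 h2 hd
    have hpre : M.ahead i u v <+: M.ahead k u v ∨ M.ahead j u v <+: M.ahead k u v := by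
      tauto
    rw [hi.ahead_eq_cons hi' hne, hj.ahead_eq_cons hj' hne] at hpre
    obtain ⟨t, ht⟩ : ∃ t, M.ahead k u v = w :: t := by
      rcases hpre with ⟨t, ht⟩ | ⟨t, ht⟩ <;> exact ⟨_, ht.symm⟩
    exact (hk.of_ahead ht).1
  exact Or.inr ⟨k, hk', (splitOrdered_step hne hi hk hi' hk').1 h1,
    (splitOrdered_step hne hk hj hk' hj').1 h2⟩

theorem forcedAbove_step (hunav : ∀ i j : ι, i ≠ j → ¬ M.Unavoidable i j)
    (hproper : M.ProperLines) {i j : ι} {u v w : V} (hne : u ≠ w) (hi : M.usesEdge i u v)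
    (hj : M.usesEdge j u v) (hi' : M.usesEdge i v w) (hj' : M.usesEdge j v w) :
    M.ForcedAbove u v i j ↔ M.ForcedAbove v w i j := by
  refine ⟨ForcedAbove.step hunav hproper hne hi hj hi' hj', fun h => ?_⟩
  rw [forcedAbove_comm] at h ⊢
  exact ForcedAbove.step hunav hproper hne.symm (usesEdge_comm.1 hj') (usesEdge_comm.1 hi')
    (usesEdge_comm.1 hj) (usesEdge_comm.1 hi) h

theorem lineAbove_step (hunav : ∀ i j : ι, i ≠ j → ¬ M.Unavoidable i j)
    (hproper : M.ProperLines) {i j : ι} {u v w : V} (hne : u ≠ w) (hi : M.usesEdge i u v)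
    (hj : M.usesEdge j u v) (hi' : M.usesEdge i v w) (hj' : M.usesEdge j v w) :
    M.LineAbove u v i j ↔ M.LineAbove v w i j := by
  obtain ⟨-, -, hi₁⟩ := hi.of_ahead (hi.ahead_eq_cons hi' hne)
  obtain ⟨-, -, hj₁⟩ := hj.of_ahead (hj.ahead_eq_cons hj' hne)
  simp only [LineAbove, forcedAbove_step hunav hproper hne hi hj hi' hj',
    forcedAbove_step hunav hproper hne hj hi hj' hi', hi.ahead_eq_cons hi' hne,
    hj.ahead_eq_cons hj' hne, hi₁, hj₁, List.cons_prefix_cons, true_and]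

theorem LineAbove.asymm (hunav : ∀ i j : ι, i ≠ j → ¬ M.Unavoidable i j) (hproper : M.ProperLines)
    {i j : ι} {u v : V} (hi : M.usesEdge i u v) (hj : M.usesEdge j u v)
    (h : M.LineAbove u v i j) : ¬ M.LineAbove u v j i := by
  rw [← above_iff_lineAbove hi hj] at h
  rw [← above_iff_lineAbove hj hi]
  exact (twoSided hunav hproper u v).above_asymm h

theorem exists_layout [Finite ι] (hunav : ∀ i j : ι, i ≠ j → ¬ M.Unavoidable i j)
    (hproper : M.ProperLines) :
    ∃ lay : M.Layout, ∀ u v i j, [i, j] <+ lay.ord u v → M.LineAbove u v i j := by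
  have key : ∀ u v, ∃ l : List ι, l.Nodup ∧ (∀ i, i ∈ l ↔ M.usesEdge i u v) ∧
      ∀ i j, [i, j] <+ l → M.LineAbove u v i j := by
    intro u v
    have h := twoSided hunav hproper u v
    refine List.exists_nodup_pair_sublist_imp {i | M.usesEdge i u v} _ ?_ ?_
    · intro a b c ha hb hc hab hbc
      rw [← above_iff_lineAbove ‹_› ‹_›] at hab hbc ⊢
      exact h.above_trans hab hbc
    · intro a b ha hb hab
      rw [← above_iff_lineAbove ha hb, ← above_iff_lineAbove hb ha]
      exact h.above_total (by simpa using hab)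
  choose ord hnodup hmem hord using key
  exact ⟨⟨ord, hnodup, hmem⟩, hord⟩

end MLCMInstance
end Layouts

section CrossingFree
open scoped List

/-- Keeping `a` and `b` in a duplicate-free list leaves them in their relative order. -/
theorem List.filter_pair_of_sublist {α : Type} [DecidableEq α] {l : List α} {a b : α} (h : l.Nodup)
    (hab : [a, b] <+ l) : l.filter (fun c => c = a ∨ c = b) = [a, b] := by
  have h1 : [a, b] <+ l.filter (fun c => c = a ∨ c = b) := by
    simpa using hab.filter (fun c => c = a ∨ c = b)
  refine (h1.eq_of_length_le ?_).symm
  exact (List.subperm_of_subset (h.filter _) fun c hc => by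
    simpa using (List.mem_filter.1 hc).2).length_le

theorem List.flatMap_eq_of_forall_ne {α β : Type} {l : List α} {f : α → List β} {a : α}
    (h : l.Nodup) (ha : a ∈ l) (hf : ∀ b ∈ l, b ≠ a → f b = []) : l.flatMap f = f a := by
  obtain ⟨p, q, rfl⟩ := List.append_of_mem ha
  have hn := (List.perm_middle.nodup_iff).1 h
  rw [List.nodup_cons] at hn
  have key : ∀ m : List α, m ⊆ p ++ q → m.flatMap f = [] := fun m hm =>
    List.flatMap_eq_nil_iff.2 fun b hb => hf b (by have := hm hb; simp at this ⊢; tauto)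
      (by rintro rfl; exact hn.1 (hm hb))
  simp [key p (by simp), key q (by simp)]

theorem List.not_alternating_sublist_rotate {α : Type} {a b c d : α} (hcd : c ≠ d) (n : ℕ) :
    ¬ [c, d, c, d] <+ ([a, b] ++ [b, a]).rotate n := by
  intro h
  have h1 := h.eq_of_length (by simp)
  rw [← List.rotate_mod] at h1
  have h2 : n % ([a, b] ++ [b, a]).length < 4 := Nat.mod_lt _ (by simp)
  generalize n % ([a, b] ++ [b, a]).length = m at h1 h2
  interval_cases m <;> simp at h1 <;> grind

namespace MLCMInstance
variable {V ι : Type} {M : MLCMInstance V ι}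

theorem usesEdge_of_pair {lay : M.Layout} {u v : V} {i j : ι} (h : [i, j] <+ lay.ord u v) :
    M.usesEdge i u v ∧ M.usesEdge j u v :=
  ⟨(lay.mem_iff u v i).1 (h.subset (by simp)), (lay.mem_iff u v j).1 (h.subset (by simp))⟩

theorem not_edgeCross (hunav : ∀ i j : ι, i ≠ j → ¬ M.Unavoidable i j) (hproper : M.ProperLines)
    {lay : M.Layout} (hlay : ∀ u v i j, [i, j] <+ lay.ord u v → M.LineAbove u v i j) (i j : ι)
    (u v : V) : ¬ EdgeCross lay i j u v := by
  rintro ⟨-, h, h'⟩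
  obtain ⟨hi, hj⟩ := usesEdge_of_pair h
  exact (hlay u v i j h).asymm hunav hproper hi hj (lineAbove_comm.1 (hlay v u i j h'))

/-- A line meets at most two ports at a vertex. -/
theorem usesEdge.eq_or_eq {i : ι} {w x x' y : V} (hx : M.usesEdge i w x) (hx' : M.usesEdge i w x')
    (hy : M.usesEdge i w y) (hne : x ≠ x') : y = x ∨ y = x' := by
  by_contra! h
  have h1 := (usesEdge_comm.1 hx).ahead_eq_cons hx' hne
  have h2 := (usesEdge_comm.1 hx).ahead_eq_cons hy h.1.symm
  rw [h1, List.cons.injEq] at h2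
  exact h.2 h2.1.symm

/-- Two lines with the same two ports at `w`, ordered oppositely, do not alternate around `w`. -/
theorem not_vertexCross_of_opposite (lay : M.Layout) {i j a b : ι} {w x y : V} (hxy : x ≠ y)
    (hab : a = i ∧ b = j ∨ a = j ∧ b = i)
    (h : [a, b] <+ lay.ord w x) (h' : [b, a] <+ lay.ord w y) : ¬ VertexCross lay i j w := by
  classical
  rintro ⟨hij, n, hs⟩
  obtain ⟨hax, hbx⟩ := usesEdge_of_pair h
  obtain ⟨hby, hay⟩ := usesEdge_of_pair h'
  obtain ⟨p, q, hr⟩ := List.append_of_mem ((M.G.rot_mem w x).2 hax.adj)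
  have hn := M.G.rot_nodup w
  rw [hr] at hn
  have hn' : (x :: (q ++ p)).Nodup := (List.perm_append_comm (l₁ := x :: q)).nodup_iff.2 hn
  rw [List.nodup_cons] at hn'
  have hy : y ∈ q ++ p := by
    have := (M.G.rot_mem w y).2 hay.adj
    simp only [hr, List.mem_append, List.mem_cons] at this ⊢
    have := hxy.symm
    tauto
  set c : ι → Bool := fun k => k = a ∨ k = b with hc
  have hrot : cyclicAt lay w ~r lay.ord w x ++ (q ++ p).flatMap (lay.ord w) := by
    have : cyclicAt lay w = p.flatMap (lay.ord w) ++ (x :: q).flatMap (lay.ord w) := by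
      simp [cyclicAt, hr]
    rw [this]
    refine List.isRotated_append.trans ?_
    simp [List.IsRotated.refl]
  have hrest : ((q ++ p).flatMap (lay.ord w)).filter c = [b, a] := by
    rw [List.filter_flatMap, List.flatMap_eq_of_forall_ne hn'.2 hy]
    · have := List.filter_pair_of_sublist (lay.nodup w y) h'
      rw [← this]
      congr 1
      ext k
      simp [hc, or_comm]
    · intro z hz hzy
      have hzx : z ≠ x := by
        rintro rfl
        exact hn'.1 hz
      rw [List.filter_eq_nil_iff]
      intro k hk hck
      have hk' := (lay.mem_iff w z k).1 hk
      rcases (by simpa [hc] using hck : k = a ∨ k = b) with rfl | rfl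
      · exact (hax.eq_or_eq hay hk' hxy).elim hzx hzy
      · exact (hbx.eq_or_eq hby hk' hxy).elim hzx hzy
  obtain ⟨m, hm⟩ := hrot.symm.trans (List.IsRotated.forall (cyclicAt lay w) n).symm
  rw [← hm] at hs
  obtain ⟨m', hm'⟩ := (List.exists_sublist_rotate_filter_iff c
    (by rcases hab with ⟨rfl, rfl⟩ | ⟨rfl, rfl⟩ <;> simp [hc])).2 ⟨m, hs⟩
  rw [List.filter_append, hrest, List.filter_pair_of_sublist (lay.nodup w x) h] at hm'
  exact List.not_alternating_sublist_rotate hij _ hm'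

theorem VertexCross.exists_ne {lay : M.Layout} {i j : ι} {w : V} (h : VertexCross lay i j w)
    (x : V) : (∃ y, y ≠ x ∧ M.usesEdge i w y) ∧ ∃ y, y ≠ x ∧ M.usesEdge j w y := by
  classical
  obtain ⟨hij, n, hs⟩ := h
  have key : ∀ k, 2 ≤ [i, j, i, j].count k → ∃ y, y ≠ x ∧ M.usesEdge k w y := by
    intro k hk
    have h1 : 2 ≤ (cyclicAt lay w).count k :=
      (hk.trans (hs.count_le k)).trans_eq ((List.rotate_perm _ _).count_eq k)
    obtain ⟨y, -, hy, hm⟩ := List.exists_ne_of_two_le_count_flatMap (M.G.rot_nodup w)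
      (fun a _ => lay.nodup w a) h1 x
    exact ⟨y, hy, (lay.mem_iff w y k).1 hm⟩
  exact ⟨key i (by simp [hij.symm]), key j (by simp [hij])⟩

theorem splitOrdered_total_of_ne {i j : ι} {w x y z : V} (hi : M.usesEdge i w x)
    (hj : M.usesEdge j w x) (hy : M.usesEdge i w y) (hz : M.usesEdge j w z) (hyx : y ≠ x)
    (hzx : z ≠ x) (hyz : y ≠ z) : M.SplitOrdered w x i j ∨ M.SplitOrdered w x j i := by
  simp only [SplitOrdered, (usesEdge_comm.1 hi).ahead_eq_cons hy hyx.symm,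
    (usesEdge_comm.1 hj).ahead_eq_cons hz hzx.symm, EmbeddedGraph.SplitAbove]
  have := EmbeddedGraph.clockwise_total hi.adj hy.adj hz.adj hyx hzx hyz
  tauto

theorem not_vertexCross (hunav : ∀ i j : ι, i ≠ j → ¬ M.Unavoidable i j) (hproper : M.ProperLines)
    {lay : M.Layout} (hlay : ∀ u v i j, [i, j] <+ lay.ord u v → M.LineAbove u v i j) (i j : ι)
    (w : V) : ¬ VertexCross lay i j w := by
  classical
  intro hcross
  obtain ⟨hij, n, hs⟩ := id hcross
  obtain ⟨lay₀, hc₀⟩ := not_forall.1 (hunav i j hij)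
  set c : ι → Bool := fun k => k = i ∨ k = j with hc
  by_cases hagree : ∀ x a b, c a → c b → [a, b] <+ lay₀.ord w x → [a, b] <+ lay.ord w x
  · refine hc₀ (Or.inr ⟨w, Or.inl ⟨hij, ?_⟩⟩)
    have heq : (cyclicAt lay w).filter c = (cyclicAt lay₀ w).filter c := by
      simp only [cyclicAt, List.filter_flatMap]
      refine congrArg (fun f => List.flatMap f _) (funext fun x => ?_)
      exact List.filter_pair_eq c (lay.nodup w x) (lay₀.nodup w x)
        (fun a => (lay.mem_iff w x a).trans (lay₀.mem_iff w x a).symm) (hagree x)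
    have hmem : ∀ a ∈ [i, j, i, j], c a := by simp [hc]
    rw [← List.exists_sublist_rotate_filter_iff c hmem, ← heq,
      List.exists_sublist_rotate_filter_iff c hmem]
    exact ⟨n, hs⟩
  · push Not at hagree
    obtain ⟨x, a, b, ha, hb, h₀, hnot⟩ := hagree
    have hne : a ≠ b := by
      rintro rfl
      exact absurd (h₀.nodup (lay₀.nodup w x)) (by simp)
    have hab : a = i ∧ b = j ∨ a = j ∧ b = i := by
      simp only [hc, decide_eq_true_eq] at ha hb
      grind
    have hc₁ : ¬ Crosses lay₀ a b := by
      rcases hab with ⟨rfl, rfl⟩ | ⟨rfl, rfl⟩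
      exacts [hc₀, fun h => hc₀ h.symm]
    obtain ⟨hax, hbx⟩ := usesEdge_of_pair h₀
    have hba := sublist_ord_of_not_sublist (lay := lay) hne hax hbx hnot
    have hsplit : ¬ (M.SplitOrdered w x a b ∨ M.SplitOrdered w x b a) := by
      rintro (h | h)
      · exact LineAbove.asymm hunav hproper hax hbx (Or.inl (Or.inl h)) (hlay w x b a hba)
      · exact (lay₀.nodup w x).pair_asymm h₀
          (sublist_ord_of_splitOrdered (fun h => hc₁ h.symm) hne.symm hbx hax h)
    obtain ⟨⟨y, hyx, hy⟩, z, hzx, hz⟩ : (∃ y, y ≠ x ∧ M.usesEdge a w y) ∧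
        ∃ y, y ≠ x ∧ M.usesEdge b w y := by
      rcases hab with ⟨rfl, rfl⟩ | ⟨rfl, rfl⟩
      exacts [hcross.exists_ne x, (hcross.exists_ne x).symm]
    have hyz : y = z := by
      by_contra h
      exact hsplit (splitOrdered_total_of_ne hax hbx hy hz hyx hzx h)
    subst hyz
    have hord : [a, b] <+ lay.ord w y := by
      refine sublist_ord_of_not_sublist hne.symm hz hy fun h => ?_
      have h1 := lineAbove_comm.1 (hlay w x b a hba)
      rw [lineAbove_step hunav hproper hyx.symm (usesEdge_comm.1 hax) (usesEdge_comm.1 hbx) hy hz]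
        at h1
      exact h1.asymm hunav hproper hy hz (hlay w y b a h)
    exact not_vertexCross_of_opposite lay hyx.symm (by tauto) hba hord hcross

theorem exists_crossingFree [Finite ι] (hunav : ∀ i j : ι, i ≠ j → ¬ M.Unavoidable i j)
    (hproper : M.ProperLines) : ∃ lay : M.Layout, CrossingFree lay := by
  obtain ⟨lay, hlay⟩ := exists_layout hunav hproper
  refine ⟨lay, ?_⟩
  rintro i j - (⟨u, v, h | h⟩ | ⟨w, h | h⟩)
  exacts [not_edgeCross hunav hproper hlay _ _ _ _ h, not_edgeCross hunav hproper hlay _ _ _ _ h,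
    not_vertexCross hunav hproper hlay _ _ _ h, not_vertexCross hunav hproper hlay _ _ _ h]

theorem CrossingFree.feasible {lay : M.Layout} (h : CrossingFree lay) : Feasible lay :=
  fun i j u hc => absurd (Or.inr ⟨u, Or.inl hc⟩) (h i j hc.1)

end MLCMInstance
end CrossingFree

open MLCMInstance in
/-- Let `(G, L)` be an instance of MLCM with no unavoidable
crossings in which no line is a subpath of another and every overlapping pair
of lines has a separator.  Then for every edge `e = (u, v)` the directed
relation graph `G_e` (on the lines through `e`, with an arc `(i, j)` whenever
`i` and `j` split so that `i` must be above `j` on `e` in every crossing-free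
solution) is acyclic. -/
theorem mlcm_relation_graphs_acyclic
    {V ι : Type} [Fintype ι] (M : MLCMInstance V ι)
    (hunav : ∀ i j : ι, i ≠ j → ¬ M.Unavoidable i j)
    (hproper : M.ProperLines)
    (hsep : ∀ (i j : ι) (P : List V) (u v : V),
      M.OverlappingPair i j P u v → ∃ l, M.Separator i j P l) :
    ∀ u v : V, M.G.adj u v → ∀ i : ι, ¬ Relation.TransGen (M.RelArc u v) i i := by
  intro u v _ i hi
  obtain ⟨lay, hlay⟩ := exists_crossingFree hunav hproper
  have key : ∀ j, Relation.TransGen (M.RelArc u v) i j → List.Sublist [i, j] (lay.ord u v) := by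
    intro j hj
    induction hj with
    | single h => exact h.2.2.2.2 lay hlay.feasible hlay
    | tail _ h ih => exact (lay.nodup u v).pair_trans ih (h.2.2.2.2 lay hlay.feasible hlay)
  exact absurd ((key i hi).nodup (lay.nodup u v)) (by simp)
end

section
/- Let G = (V, E) be an almost bipartite graph with special vertices b and t. The minimum, over all partitions of V into sets S_b and S_t with b ∈ S_b and t ∈ S_t, of the number of uncut edges (edges with both endpoints in the same set) equals the maximum number of pairwise edge-disjoint subgraphs of G, each of which is a closed walk of odd length through b using no edge twice, a closed walk of odd length through t using no edge twice, or a path of even length between b and t. -/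
/-- An edge is uncut (w.r.t. the partition `(S, Sᶜ)` of the vertices) if both
of its endpoints lie in the same part. -/
def UncutEdge {V : Type} (S : Set V) (e : Sym2 V) : Prop :=
  (∀ x ∈ e, x ∈ S) ∨ (∀ x ∈ e, x ∉ S)

/-- The number of uncut edges of `G` w.r.t. the partition `(S, Sᶜ)`. -/
noncomputable def uncutCount {V : Type} (G : SimpleGraph V) (S : Set V) : ℕ :=
  Nat.card {e : Sym2 V // e ∈ G.edgeSet ∧ UncutEdge S e}

/-- A graph is almost bipartite with special vertices `b` and `t`:
removing `b` and `t` leaves a bipartite graph (all remaining edges are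
incident to `b` or to `t`). -/
def AlmostBipartite {V : Type} (G : SimpleGraph V) (b t : V) : Prop :=
  b ≠ t ∧ ∃ C : Set V, ∀ ⦃u v : V⦄, G.Adj u v →
    u ≠ b → u ≠ t → v ≠ b → v ≠ t → (u ∈ C ↔ v ∉ C)

/-- One of the special subgraphs: a closed walk of odd length through `b`
using no edge twice, a closed walk of odd length through `t` using no edge
twice, or a path of even length between `b` and `t`. -/
structure SpecialPiece {V : Type} (G : SimpleGraph V) (b t : V) where
  src : V
  dst : V
  walk : G.Walk src dst
  cond : (src = b ∧ dst = b ∧ Odd walk.length ∧ walk.edges.Nodup) ∨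
         (src = t ∧ dst = t ∧ Odd walk.length ∧ walk.edges.Nodup) ∨
         (src = b ∧ dst = t ∧ walk.IsPath ∧ Even walk.length)

/-- A unit-capacity integral flow on `G` from `s` to `t`, of value `n`. -/
structure UnitFlow {V : Type} [Fintype V] [DecidableEq V] (G : SimpleGraph V) (s t : V) (n : ℤ)
    (f : V → V → ℤ) : Prop where
  antisymm : ∀ x y, f x y = - f y x
  le_one : ∀ x y, f x y ≤ 1
  adj : ∀ x y, f x y ≠ 0 → G.Adj x y
  conserve : ∀ x, ∑ y, f x y = if x = s then n else if x = t then -n else 0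

namespace SimpleGraph.Walk

variable {V : Type} [DecidableEq V] {G : SimpleGraph V}

/-- The net number of times a walk traverses the dart `(x, y)`. -/
def netFlow {u v : V} (p : G.Walk u v) (x y : V) : ℤ :=
  (p.darts.map (·.toProd)).count (x, y) - (p.darts.map (·.toProd)).count (y, x)

theorem netFlow_antisymm {u v : V} (p : G.Walk u v) (x y : V) :
    p.netFlow x y = - p.netFlow y x := by
  simp [netFlow]

theorem sum_netFlow [Fintype V] {u v : V} (p : G.Walk u v) (x : V) :
    ∑ y, p.netFlow x y = (if x = u then 1 else 0) - (if x = v then 1 else 0) := by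
  induction p with
  | nil => simp [netFlow]
  | @cons u w v h p ih =>
    have key : ∀ y, (cons h p).netFlow x y = p.netFlow x y +
        ((if x = u then (if y = w then 1 else 0) else 0)
          - (if x = w then (if y = u then 1 else 0) else 0)) := by
      intro y
      simp only [netFlow, darts_cons, List.map_cons, List.count_cons, beq_iff_eq, Prod.mk.injEq]
      push_cast
      grind
    simp only [key, Finset.sum_add_distrib, Finset.sum_sub_distrib, ih]
    by_cases h1 : x = u <;> by_cases h2 : x = w <;> simp [h1, h2]

theorem mk_mem_edges_of_netFlow_ne_zero {u v : V} (p : G.Walk u v) {x y : V}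
    (h : p.netFlow x y ≠ 0) : s(x, y) ∈ p.edges := by
  by_contra hne
  have aux : ∀ a b : V, s(a, b) = s(x, y) → (p.darts.map (·.toProd)).count (a, b) = 0 := by
    intro a b hab
    rw [List.count_eq_zero]
    intro hm
    obtain ⟨d, hd, hd'⟩ := List.mem_map.1 hm
    exact hne (List.mem_map.2 ⟨d, hd, by rw [← hab, Dart.edge, hd']⟩)
  exact h (by simp [netFlow, aux x y rfl, aux y x Sym2.eq_swap])

theorem IsTrail.netFlow_of_mem {u v : V} {p : G.Walk u v} (hp : p.IsTrail) {d : G.Dart}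
    (hd : d ∈ p.darts) : p.netFlow d.fst d.snd = 1 := by
  have hnd : p.darts.Nodup := List.Nodup.of_map _ hp.edges_nodup
  have h1 : (p.darts.map (·.toProd)).count (d.fst, d.snd) = 1 :=
    List.count_eq_one_of_mem (hnd.map (fun a b h => Dart.ext _ _ h)) (List.mem_map.2 ⟨d, hd, rfl⟩)
  have h2 : (p.darts.map (·.toProd)).count (d.snd, d.fst) = 0 := by
    rw [List.count_eq_zero]
    intro hm
    obtain ⟨d', hd', he⟩ := List.mem_map.1 hm
    have hds : d' = d.symm := Dart.ext _ _ (by rw [he]; rfl)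
    have : d' = d := List.inj_on_of_nodup_map hp.edges_nodup hd' hd (by simp [hds])
    exact d.symm_ne (hds.symm.trans this)
  simp [netFlow, h1, h2]

end SimpleGraph.Walk

theorem SimpleGraph.exists_path_or_cut {V : Type} [DecidableEq V] (G : SimpleGraph V) (s t : V)
    (R : V → V → Prop) (hR : ∀ x y, R x y → G.Adj x y) :
    (∃ p : G.Walk s t, p.IsPath ∧ ∀ d ∈ p.darts, R d.fst d.snd) ∨
      ∃ S : Set V, s ∈ S ∧ t ∉ S ∧ ∀ x ∈ S, ∀ y ∉ S, ¬ R x y := by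
  by_cases h : ∃ p : G.Walk s t, ∀ d ∈ p.darts, R d.fst d.snd
  · obtain ⟨p, hp⟩ := h
    exact .inl ⟨p.bypass, p.bypass_isPath, fun d hd => hp d (p.darts_bypass_subset_darts hd)⟩
  · refine .inr ⟨{v | ∃ p : G.Walk s v, ∀ d ∈ p.darts, R d.fst d.snd}, ⟨.nil, by simp⟩, h, ?_⟩
    rintro x ⟨p, hp⟩ y hy hxy
    refine hy ⟨p.concat (hR x y hxy), fun d hd => ?_⟩
    rw [Walk.darts_concat, List.concat_eq_append, List.mem_append, List.mem_singleton] at hd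
    rcases hd with hd | rfl
    exacts [hp d hd, hxy]

namespace UnitFlow

open SimpleGraph

variable {V : Type} [Fintype V] [DecidableEq V] {G : SimpleGraph V} {s t : V} {n : ℤ}
  {f : V → V → ℤ}

theorem zero (G : SimpleGraph V) (s t : V) : UnitFlow G s t 0 fun _ _ => 0 :=
  ⟨by simp, by simp, by simp, by simp⟩

theorem cut_eq (hf : UnitFlow G s t n f) (S : Finset V) (hs : s ∈ S) (ht : t ∉ S) :
    ∑ x ∈ S, ∑ y ∈ Sᶜ, f x y = n := by
  have h1 : ∑ x ∈ S, ∑ y, f x y = n := by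
    rw [Finset.sum_eq_single_of_mem s hs]
    · simp [hf.conserve]
    · intro x hx hxs
      have : x ≠ t := fun h => ht (h ▸ hx)
      simp [hf.conserve, hxs, this]
  have h2 : ∑ x ∈ S, ∑ y ∈ S, f x y = 0 := by
    have : ∑ x ∈ S, ∑ y ∈ S, f x y = - ∑ x ∈ S, ∑ y ∈ S, f x y := by
      conv_lhs => rw [Finset.sum_comm]
      simp only [← Finset.sum_neg_distrib]
      exact Finset.sum_congr rfl fun x _ => Finset.sum_congr rfl fun y _ => hf.antisymm y x
    omega
  have h3 : ∀ x ∈ S, ∑ y, f x y = ∑ y ∈ S, f x y + ∑ y ∈ Sᶜ, f x y := fun x _ =>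
    (Finset.sum_add_sum_compl S _).symm
  rw [Finset.sum_congr rfl h3, Finset.sum_add_distrib, h2] at h1
  omega

theorem le_card (hst : s ≠ t) (hf : UnitFlow G s t n f) : n ≤ Fintype.card V := by
  have h := hf.cut_eq {s} (by simp) (by simpa using hst.symm)
  rw [Finset.sum_singleton] at h
  calc n = ∑ y ∈ {s}ᶜ, f s y := h.symm
    _ ≤ ∑ y ∈ ({s}ᶜ : Finset V), 1 := Finset.sum_le_sum fun y _ => hf.le_one s y
    _ ≤ Fintype.card V := by simpa using Finset.card_le_univ _

theorem augment (hst : s ≠ t) (hf : UnitFlow G s t n f) {p : G.Walk s t} (hp : p.IsTrail)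
    (hres : ∀ d ∈ p.darts, f d.fst d.snd ≤ 0) :
    UnitFlow G s t (n + 1) fun x y => f x y + p.netFlow x y := by
  refine ⟨fun x y => ?_, fun x y => ?_, fun x y h => ?_, fun x => ?_⟩
  · rw [hf.antisymm x y, p.netFlow_antisymm x y]; ring
  · by_cases h0 : p.netFlow x y = 0
    · simpa [h0] using hf.le_one x y
    obtain ⟨d, hd, he⟩ := List.mem_map.1 (p.mk_mem_edges_of_netFlow_ne_zero h0)
    have h1 := hp.netFlow_of_mem hd
    have h2 := hres d hd
    have h3 := hf.le_one x y
    rcases Sym2.eq_iff.1 (show s(d.fst, d.snd) = s(x, y) from he) with ⟨rfl, rfl⟩ | ⟨rfl, rfl⟩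
    · linarith
    · rw [p.netFlow_antisymm]; linarith
  · by_cases h0 : p.netFlow x y = 0
    · exact hf.adj x y (by simpa [h0] using h)
    · exact p.adj_of_mem_edges (p.mk_mem_edges_of_netFlow_ne_zero h0)
  · rw [Finset.sum_add_distrib, hf.conserve, p.sum_netFlow]
    by_cases h1 : x = s
    · subst h1; simp [hst]
    · by_cases h2 : x = t
      · subst h2; simp [h1]; ring
      · simp [h1, h2]

theorem remove (hst : s ≠ t) (hf : UnitFlow G s t n f) {p : G.Walk s t} (hp : p.IsTrail)
    (hres : ∀ d ∈ p.darts, f d.fst d.snd = 1) :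
    UnitFlow G s t (n - 1) fun x y => f x y - p.netFlow x y := by
  refine ⟨fun x y => ?_, fun x y => ?_, fun x y h => ?_, fun x => ?_⟩
  · rw [hf.antisymm x y, p.netFlow_antisymm x y]; ring
  · by_cases h0 : p.netFlow x y = 0
    · simpa [h0] using hf.le_one x y
    obtain ⟨d, hd, he⟩ := List.mem_map.1 (p.mk_mem_edges_of_netFlow_ne_zero h0)
    have h1 := hp.netFlow_of_mem hd
    have h2 := hres d hd
    rcases Sym2.eq_iff.1 (show s(d.fst, d.snd) = s(x, y) from he) with ⟨rfl, rfl⟩ | ⟨rfl, rfl⟩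
    · linarith
    · rw [p.netFlow_antisymm, hf.antisymm]; linarith
  · by_cases h0 : p.netFlow x y = 0
    · exact hf.adj x y (by simpa [h0] using h)
    · exact p.adj_of_mem_edges (p.mk_mem_edges_of_netFlow_ne_zero h0)
  · rw [Finset.sum_sub_distrib, hf.conserve, p.sum_netFlow]
    by_cases h1 : x = s
    · subst h1; simp [hst]
    · by_cases h2 : x = t
      · subst h2; simp [h1]; ring
      · simp [h1, h2]

theorem exists_paths (hst : s ≠ t) {k : ℕ} (hf : UnitFlow G s t k f) :
    ∃ P : Fin k → G.Path s t, (∀ i, ∀ d ∈ (P i).1.darts, f d.fst d.snd = 1) ∧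
      ∀ i j, i ≠ j → ∀ e ∈ (P i).1.edges, e ∉ (P j).1.edges := by
  induction k generalizing f with
  | zero => exact ⟨Fin.elim0, fun i => i.elim0, fun i => i.elim0⟩
  | succ k ih =>
    classical
    rcases G.exists_path_or_cut s t (fun x y => f x y = 1)
      (fun x y h => hf.adj x y (by rw [h]; simp)) with ⟨p, hp, hd⟩ | ⟨S, hs, ht, hS⟩
    · have hf' := hf.remove hst hp.isTrail hd
      rw [Nat.cast_succ, add_sub_cancel_right] at hf'
      obtain ⟨P, hP, hdis⟩ := ih hf'
      have hzero : ∀ i, ∀ d ∈ (P i).1.darts, d.edge ∉ p.edges ∧ f d.fst d.snd = 1 := by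
        intro i d hdi
        have h1 := hP i d hdi
        have hnot : d.edge ∉ p.edges := by
          intro hmem
          obtain ⟨d', hd', he⟩ := List.mem_map.1 hmem
          have h2 := hd d' hd'
          have h3 := hp.isTrail.netFlow_of_mem hd'
          rcases Sym2.eq_iff.1 (show s(d'.fst, d'.snd) = s(d.fst, d.snd) from he) with
            ⟨h, h'⟩ | ⟨h, h'⟩
          · rw [← h, ← h'] at h1; omega
          · rw [← h, ← h', hf.antisymm, p.netFlow_antisymm] at h1; omega
        have h0 : p.netFlow d.fst d.snd = 0 := by
          by_contra h0
          exact hnot (p.mk_mem_edges_of_netFlow_ne_zero h0)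
        exact ⟨hnot, by omega⟩
      have hnew : ∀ i, ∀ e ∈ (P i).1.edges, e ∉ p.edges := by
        intro i e he
        obtain ⟨d, hd, rfl⟩ := List.mem_map.1 he
        exact (hzero i d hd).1
      refine ⟨Fin.cons ⟨p, hp⟩ P, fun i => ?_, fun i j hij => ?_⟩
      · refine Fin.cases ?_ (fun i => ?_) i
        · exact hd
        · exact fun d hdi => (hzero i d hdi).2
      · induction i using Fin.cases with
        | zero =>
          induction j using Fin.cases with
          | zero => exact absurd rfl hij
          | succ j => exact fun e he he' => hnew j e he' he
        | succ i =>
          induction j using Fin.cases with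
          | zero => exact hnew i
          | succ j => exact hdis i j fun h => hij (h ▸ rfl)
    · have hcut := hf.cut_eq S.toFinset (by simpa) (by simpa)
      have : ∑ x ∈ S.toFinset, ∑ y ∈ S.toFinsetᶜ, f x y ≤ 0 :=
        Finset.sum_nonpos fun x hx => Finset.sum_nonpos fun y hy => by
          have h1 := hS x (by simpa using hx) y (by simpa using hy)
          have h2 := hf.le_one x y
          omega
      push_cast at hcut
      omega

end UnitFlow

/-- The edge version of Menger's theorem for finite simple graphs. -/
theorem SimpleGraph.exists_edgeDisjoint_paths_and_cut {V : Type} [Fintype V] [DecidableEq V]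
    (G : SimpleGraph V) {s t : V} (hst : s ≠ t) :
    ∃ (k : ℕ) (P : Fin k → G.Path s t) (S : Set V),
      (∀ i j, i ≠ j → ∀ e ∈ (P i).1.edges, e ∉ (P j).1.edges) ∧ s ∈ S ∧ t ∉ S ∧
      {d : V × V | d.1 ∈ S ∧ d.2 ∉ S ∧ G.Adj d.1 d.2}.ncard = k := by
  classical
  by_contra hno
  have hall : ∀ n : ℕ, ∃ f, UnitFlow G s t n f := by
    intro n
    induction n with
    | zero => exact ⟨_, UnitFlow.zero G s t⟩
    | succ n ih =>
      obtain ⟨f, hf⟩ := ih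
      rcases G.exists_path_or_cut s t (fun x y => G.Adj x y ∧ f x y ≤ 0) (fun x y h => h.1) with
        ⟨p, hp, hd⟩ | ⟨S, hs, ht, hS⟩
      · exact ⟨_, by simpa using hf.augment hst hp.isTrail fun d h => (hd d h).2⟩
      · refine absurd ?_ hno
        obtain ⟨P, -, hdis⟩ := hf.exists_paths hst
        refine ⟨n, P, S, hdis, hs, ht, ?_⟩
        have hcut := hf.cut_eq S.toFinset (by simpa) (by simpa)
        have hval : ∀ x ∈ S.toFinset, ∀ y ∈ S.toFinsetᶜ,
            f x y = if G.Adj x y then 1 else 0 := by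
          intro x hx y hy
          have h1 := hS x (by simpa using hx) y (by simpa using hy)
          have h2 := hf.le_one x y
          split_ifs with h
          · have : ¬ f x y ≤ 0 := fun h' => h1 ⟨h, h'⟩
            omega
          · by_contra h3
            exact h (hf.adj x y h3)
        rw [Finset.sum_congr rfl fun x hx => Finset.sum_congr rfl (hval x hx),
          ← Finset.sum_product', Finset.sum_boole] at hcut
        rw [Set.ncard_eq_toFinset_card']
        rw [← Nat.cast_inj (R := ℤ), ← hcut]
        congr 2
        ext d
        simp [and_assoc]
  obtain ⟨f, hf⟩ := hall (Fintype.card V + 1)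
  have := hf.le_card hst
  push_cast at this
  omega

section Twist

variable {V : Type} [DecidableEq V]

open Classical in
/-- Exchange the special vertices `b` and `t` on the edges that meet `D`. -/
noncomputable def twistEdge (b t : V) (D : Set V) (e : Sym2 V) : Sym2 V :=
  if ∃ v ∈ e, v ∈ D then e.map (Equiv.swap b t) else e

variable {b t : V} {D : Set V}

theorem twistEdge_of_mem {u v : V} (hv : v ∈ D) :
    twistEdge b t D s(u, v) = s(Equiv.swap b t u, Equiv.swap b t v) :=
  if_pos ⟨v, by simp, hv⟩

theorem twistEdge_of_notMem {u v : V} (hu : u ∉ D) (hv : v ∉ D) :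
    twistEdge b t D s(u, v) = s(u, v) :=
  if_neg (by simp [hu, hv])

theorem twistEdge_of_ne {u v : V} (hub : u ≠ b) (hut : u ≠ t) (hvb : v ≠ b) (hvt : v ≠ t) :
    twistEdge b t D s(u, v) = s(u, v) := by
  unfold twistEdge
  split_ifs
  · simp [Equiv.swap_apply_of_ne_of_ne, *]
  · rfl

theorem twistEdge_twistEdge (hb : b ∉ D) (ht : t ∉ D) (e : Sym2 V) :
    twistEdge b t D (twistEdge b t D e) = e := by
  have hD : ∀ v ∈ D, Equiv.swap b t v = v := fun v hv =>
    Equiv.swap_apply_of_ne_of_ne (fun h => hb (h ▸ hv)) (fun h => ht (h ▸ hv))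
  by_cases h : ∃ v ∈ e, v ∈ D
  · obtain ⟨v, hv, hvD⟩ := h
    have h1 : twistEdge b t D e = e.map (Equiv.swap b t) := if_pos ⟨v, hv, hvD⟩
    have h2 : twistEdge b t D (e.map (Equiv.swap b t)) =
        (e.map (Equiv.swap b t)).map (Equiv.swap b t) :=
      if_pos ⟨v, Sym2.mem_map.2 ⟨v, hv, hD v hvD⟩, hvD⟩
    rw [h1, h2, Sym2.map_map]
    have h3 : Equiv.swap b t ∘ Equiv.swap b t = id := funext (Equiv.swap_apply_self b t)
    rw [h3, Sym2.map_id, id]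
  · have h1 : twistEdge b t D e = e := if_neg h
    rw [h1, h1]

theorem twistEdge_injective (hb : b ∉ D) (ht : t ∉ D) :
    Function.Injective (twistEdge b t D) :=
  Function.LeftInverse.injective (twistEdge_twistEdge hb ht)

/-- The graph whose edges are the twisted edges of `G`, without the edge `bt`. -/
def twistGraph (G : SimpleGraph V) (b t : V) (D : Set V) : SimpleGraph V :=
  SimpleGraph.fromEdgeSet {e | twistEdge b t D e ∈ G.edgeSet ∧ e ≠ s(b, t)}

theorem twistGraph_adj {G : SimpleGraph V} {u v : V} (h : (twistGraph G b t D).Adj u v) :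
    twistEdge b t D s(u, v) ∈ G.edgeSet ∧ s(u, v) ≠ s(b, t) :=
  ((SimpleGraph.fromEdgeSet_adj _).1 h).1

end Twist

theorem SimpleGraph.Walk.even_length_iff_of_cut {V : Type} {G : SimpleGraph V} {S : Set V}
    {u v : V} (p : G.Walk u v) (hp : ∀ e ∈ p.edges, ¬ UncutEdge S e) :
    Even p.length ↔ (u ∈ S ↔ v ∈ S) := by
  induction p with
  | nil => simp
  | @cons u w v h p ih =>
    have h1 := ih fun e he => hp e (by simp [he])
    have h2 := hp s(u, w) (by simp)
    simp only [UncutEdge, Sym2.mem_iff, forall_eq_or_imp, forall_eq] at h2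
    rw [length_cons, Nat.even_add_one, h1]
    tauto

theorem SpecialPiece.exists_uncutEdge {V : Type} {G : SimpleGraph V} {b t : V}
    (q : SpecialPiece G b t) {S : Set V} (hb : b ∈ S) (ht : t ∉ S) :
    ∃ e ∈ q.walk.edges, UncutEdge S e := by
  by_contra! hno
  have h := q.walk.even_length_iff_of_cut hno
  rcases q.cond with ⟨h1, h2, h3, -⟩ | ⟨h1, h2, h3, -⟩ | ⟨h1, h2, -, h3⟩
  · rw [← Nat.not_even_iff_odd, h, h1, h2] at h3; simp at h3
  · rw [← Nat.not_even_iff_odd, h, h1, h2] at h3; simp at h3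
  · rw [h, h1, h2] at h3; simp [hb, ht] at h3

theorem card_pieces_le_uncutCount {V : Type} [Fintype V] {G : SimpleGraph V} {b t : V} {n : ℕ}
    (f : Fin n → SpecialPiece G b t)
    (hf : ∀ a c : Fin n, a ≠ c → ∀ e : Sym2 V, e ∈ (f a).walk.edges → e ∉ (f c).walk.edges)
    {S : Set V} (hb : b ∈ S) (ht : t ∉ S) : n ≤ uncutCount G S := by
  choose e he hu using fun i => (f i).exists_uncutEdge hb ht
  have hinj : Function.Injective fun i =>
      (⟨e i, (f i).walk.edges_subset_edgeSet (he i), hu i⟩ :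
        {e : Sym2 V // e ∈ G.edgeSet ∧ UncutEdge S e}) := by
    intro i j hij
    by_contra hne
    have h1 : e i = e j := congrArg Subtype.val hij
    exact hf i j hne (e i) (he i) (h1 ▸ he j)
  simpa [uncutCount] using Nat.card_le_card_of_injective _ hinj

section AlmostBipartite

variable {V : Type} [DecidableEq V] {G : SimpleGraph V} {b t : V} {D : Set V}

theorem exists_untwisted_walk (hb : b ∉ D) (ht : t ∉ D) (hbt : b ≠ t)
    (hD : ∀ ⦃u v : V⦄, G.Adj u v → u ≠ b → u ≠ t → v ≠ b → v ≠ t → (u ∈ D ↔ v ∉ D))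
    {u z : V} (p : (twistGraph G b t D).Walk u z) (hz : z = t) (hp : p.IsPath)
    (hbp : b ∉ p.support) (hut : u ≠ t) :
    ∃ (x : V) (q : G.Walk u x), (x = b ∨ x = t) ∧ q.IsPath ∧
      (∀ y ∈ q.support, y ∈ p.support ∨ y = x) ∧
      (∀ y, y = b ∨ y = t → y ∈ q.support → y = x) ∧
      q.edges = p.edges.map (twistEdge b t D) ∧ (Odd q.length ↔ (x = t ↔ u ∉ D)) := by
  induction p with
  | nil => exact absurd hz hut
  | @cons u v z h p ih =>
    subst hz
    rename' z => t
    have hub : u ≠ b := fun h => hbp (by simp [h])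
    rw [SimpleGraph.Walk.cons_isPath_iff] at hp
    have hadj := (twistGraph_adj h).1
    by_cases hvt : v = t
    · subst hvt
      have hnil : p = .nil := by
        cases p with
        | nil => rfl
        | cons h' p' => simp at hp
      subst hnil
      by_cases huD : u ∈ D
      · have hedge : twistEdge b v D s(u, v) = s(u, b) := by
          rw [Sym2.eq_swap, twistEdge_of_mem huD, Equiv.swap_apply_right,
            Equiv.swap_apply_of_ne_of_ne hub hut, Sym2.eq_swap]
        have hadj : G.Adj u b := by rwa [hedge] at hadj
        refine ⟨b, .cons hadj .nil, .inl rfl, ?_, ?_, ?_, ?_, ?_⟩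
        · simp [hub]
        · simp
        · simp; grind
        · simp [hedge]
        · simp [hbt, huD]
      · have hedge : twistEdge b v D s(u, v) = s(u, v) := twistEdge_of_notMem huD ht
        have hadj : G.Adj u v := by rwa [hedge] at hadj
        refine ⟨v, .cons hadj .nil, .inr rfl, ?_, ?_, ?_, ?_, ?_⟩
        · simp [hut]
        · simp
        · simp; grind
        · simp [hedge]
        · simp [huD]
    · have hbp' : b ∉ p.support := fun h => hbp (by simp [h])
      have hvb : v ≠ b := fun h => hbp' (h ▸ p.start_mem_support)
      obtain ⟨x, q, hx, hq, hsup, hsp, hed, hodd⟩ := ih rfl hp.1 hbp' hvt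
      have hedge : twistEdge b t D s(u, v) = s(u, v) := twistEdge_of_ne hub hut hvb hvt
      have hadj : G.Adj u v := by rwa [hedge] at hadj
      have huq : u ∉ q.support := by
        intro hu
        rcases hsup u hu with h | rfl
        · exact hp.2 h
        · rcases hx with h | h
          exacts [hub h, hut h]
      refine ⟨x, .cons hadj q, hx, hq.cons huq, ?_, ?_, ?_, ?_⟩
      · intro y hy
        simp only [SimpleGraph.Walk.support_cons, List.mem_cons] at hy ⊢
        rcases hy with h | h
        · exact .inl (.inl h)
        · exact (hsup y h).imp .inr id
      · intro y hy hmem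
        simp only [SimpleGraph.Walk.support_cons, List.mem_cons] at hmem
        rcases hmem with rfl | h
        · rcases hy with h | h
          exacts [absurd h hub, absurd h hut]
        · exact hsp y hy h
      · simp [hed, hedge]
      · have h2 := hD hadj hub hut hvb hvt
        rw [SimpleGraph.Walk.length_cons, Nat.odd_add_one, hodd]
        tauto

theorem exists_specialPiece_of_twisted_path (hb : b ∉ D) (ht : t ∉ D) (hbt : b ≠ t)
    (hD : ∀ ⦃u v : V⦄, G.Adj u v → u ≠ b → u ≠ t → v ≠ b → v ≠ t → (u ∈ D ↔ v ∉ D))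
    (P : (twistGraph G b t D).Path b t) :
    ∃ q : SpecialPiece G b t, ∀ e ∈ q.walk.edges, ∃ e' ∈ P.1.edges, twistEdge b t D e' = e := by
  obtain ⟨p, hp⟩ := P
  have hnd : (p.edges.map (twistEdge b t D)).Nodup :=
    hp.isTrail.edges_nodup.map (twistEdge_injective hb ht)
  cases p with
  | nil => exact absurd rfl hbt
  | @cons _ v _ h p =>
    rw [SimpleGraph.Walk.cons_isPath_iff] at hp
    have hvt : v ≠ t := by
      rintro rfl
      exact (twistGraph_adj h).2 rfl
    have hvb : v ≠ b := h.ne'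
    obtain ⟨x, q, hx, hq, -, hsp, hed, hodd⟩ :=
      exists_untwisted_walk hb ht hbt hD p rfl hp.1 hp.2 hvt
    obtain ⟨y, hy, hyv, hyD⟩ : ∃ y, (y = b ∨ y = t) ∧ twistEdge b t D s(b, v) = s(y, v) ∧
        (y = t ↔ v ∈ D) := by
      by_cases hv : v ∈ D
      · exact ⟨t, .inr rfl, by
          rw [twistEdge_of_mem hv, Equiv.swap_apply_left, Equiv.swap_apply_of_ne_of_ne hvb hvt],
          by simp [hv]⟩
      · exact ⟨b, .inl rfl, twistEdge_of_notMem hb hv, by simp [hv, hbt]⟩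
    have hadj : G.Adj y v := by
      have := (twistGraph_adj h).1
      rwa [hyv] at this
    have hedges : (SimpleGraph.Walk.cons hadj q).edges =
        (SimpleGraph.Walk.cons h p).edges.map (twistEdge b t D) := by
      simp [hyv, hed]
    rw [← hedges] at hnd
    have hmem : ∀ e ∈ (SimpleGraph.Walk.cons hadj q).edges,
        ∃ e' ∈ (SimpleGraph.Walk.cons h p).edges, twistEdge b t D e' = e := fun e he =>
      List.mem_map.1 (hedges ▸ he)
    have hlen : Odd (SimpleGraph.Walk.cons hadj q).length ↔ ¬ (x = t ↔ v ∉ D) := by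
      rw [SimpleGraph.Walk.length_cons, Nat.odd_add_one, hodd]
    rcases hy with hy | hy <;> rcases hx with hx | hx
    · exact ⟨⟨y, x, _, .inl ⟨hy, hx, hlen.2 (by grind), hnd⟩⟩, hmem⟩
    · refine ⟨⟨y, x, _, .inr (.inr ⟨hy, hx, hq.cons fun h => ?_, ?_⟩)⟩, hmem⟩
      · exact hbt (hy.symm.trans ((hsp y (.inl hy) h).trans hx))
      · rw [← Nat.not_odd_iff_even, hlen]; grind
    · refine ⟨⟨x, y, (SimpleGraph.Walk.cons hadj q).reverse,
        .inr (.inr ⟨hx, hy, (hq.cons fun h => ?_).reverse, ?_⟩)⟩, fun e he => hmem e ?_⟩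
      · exact hbt (hx.symm.trans ((hsp y (.inr hy) h).symm.trans hy))
      · rw [SimpleGraph.Walk.length_reverse, ← Nat.not_odd_iff_even, hlen]; grind
      · exact List.mem_reverse.1 (SimpleGraph.Walk.edges_reverse _ ▸ he)
    · exact ⟨⟨y, x, _, .inr (.inl ⟨hy, hx, hlen.2 (by grind), hnd⟩)⟩, hmem⟩

theorem exists_uncutCount_le_of_twisted_cut [Fintype V] (hb : b ∉ D) (ht : t ∉ D)
    (hD : ∀ ⦃u v : V⦄, G.Adj u v → u ≠ b → u ≠ t → v ≠ b → v ≠ t → (u ∈ D ↔ v ∉ D))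
    {S : Set V} (hbS : b ∈ S) (htS : t ∉ S) :
    ∃ S' : Set V, b ∈ S' ∧ t ∉ S' ∧ uncutCount G S' ≤
      {d : V × V | d.1 ∈ S ∧ d.2 ∉ S ∧ (twistGraph G b t D).Adj d.1 d.2}.ncard := by
  set S' : Set V := {v | v ∈ S ↔ (v ∈ D ∨ v = b ∨ v = t)} with hS'
  refine ⟨S', by simp [hS', hbS], by simp [hS', htS], ?_⟩
  set T := {d : V × V | d.1 ∈ S ∧ d.2 ∉ S ∧ (twistGraph G b t D).Adj d.1 d.2}
  have hsub : {e | e ∈ G.edgeSet ∧ UncutEdge S' e} ⊆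
      (fun d : V × V => twistEdge b t D s(d.1, d.2)) '' T := by
    intro e he
    obtain ⟨u, v, huv⟩ : ∃ u v, twistEdge b t D e = s(u, v) := by
      induction twistEdge b t D e with | _ u v => exact ⟨u, v, rfl⟩
    have hinv : twistEdge b t D s(u, v) = e := by rw [← huv, twistEdge_twistEdge hb ht]
    have hbt' : s(u, v) ≠ s(b, t) := by
      intro h
      rw [h, twistEdge_of_notMem hb ht] at hinv
      have := he.2
      rw [← hinv] at this
      simp [UncutEdge, hS', hbS, htS] at this
    have hne : u ≠ v := by
      rintro rfl
      have h1 : e.IsDiag := by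
        rw [← hinv]
        unfold twistEdge
        split_ifs <;> simp
      exact G.not_isDiag_of_mem_edgeSet he.1 h1
    have hadj : (twistGraph G b t D).Adj u v :=
      (SimpleGraph.fromEdgeSet_adj _).2 ⟨⟨by rw [hinv]; exact he.1, hbt'⟩, hne⟩
    have hcross : u ∈ S ↔ v ∉ S := by
      have hG := he.1
      have hU := he.2
      rw [← hinv] at hG hU
      have hmem : ∀ w, w ∈ S' ↔ (w ∈ S ↔ (w ∈ D ∨ w = b ∨ w = t)) := fun _ => Iff.rfl
      have half : ∀ x y, (x = b ∨ x = t) → y ≠ b → y ≠ t →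
          UncutEdge S' (twistEdge b t D s(x, y)) → (x ∈ S ↔ y ∉ S) := by
        intro x y hx hyb hyt hxy
        have hsw := Equiv.swap_apply_of_ne_of_ne hyb hyt
        by_cases hy : y ∈ D
        · rw [twistEdge_of_mem hy, hsw] at hxy
          rcases hx with rfl | rfl <;>
            simp_all [UncutEdge]
        · have hxD : x ∉ D := by rcases hx with rfl | rfl <;> assumption
          rw [twistEdge_of_notMem hxD hy] at hxy
          rcases hx with rfl | rfl <;>
            simp_all [UncutEdge]
      by_cases hu : u = b ∨ u = t
      · by_cases hv : v = b ∨ v = t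
        · refine absurd ?_ hbt'
          rcases hu with rfl | rfl <;> rcases hv with rfl | rfl <;> simp_all
        · rw [not_or] at hv
          exact half u v hu hv.1 hv.2 hU
      · rw [not_or] at hu
        by_cases hv : v = b ∨ v = t
        · rw [Sym2.eq_swap] at hU
          have := half v u hv hu.1 hu.2 hU
          tauto
        · rw [not_or] at hv
          rw [twistEdge_of_ne hu.1 hu.2 hv.1 hv.2] at hG hU
          have h1 := hD hG hu.1 hu.2 hv.1 hv.2
          simp only [UncutEdge, Sym2.mem_iff, forall_eq_or_imp, forall_eq, hmem, hu, hv,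
            or_false] at hU
          tauto
    by_cases hu : u ∈ S
    · exact ⟨(u, v), ⟨hu, hcross.1 hu, hadj⟩, hinv⟩
    · exact ⟨(v, u), ⟨by tauto, hu, hadj.symm⟩, by rw [← hinv, Sym2.eq_swap]⟩
  calc uncutCount G S' = {e | e ∈ G.edgeSet ∧ UncutEdge S' e}.ncard := rfl
    _ ≤ ((fun d : V × V => twistEdge b t D s(d.1, d.2)) '' T).ncard :=
      Set.ncard_le_ncard hsub (Set.toFinite _)
    _ ≤ T.ncard := Set.ncard_image_le (Set.toFinite _)

end AlmostBipartite

/-- For an almost bipartite graph `G` with special vertices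
`b` and `t`, the minimum number of uncut edges over all partitions of the
vertices into `S_b ∋ b` and `S_t ∋ t` equals the maximum number of pairwise
edge-disjoint subgraphs of `G`, each of which is a closed odd walk through `b`
using no edge twice, a closed odd walk through `t` using no edge twice, or an
even path between `b` and `t`. -/
theorem almostBipartite_minUncut_eq_max_edgeDisjoint_pieces
    {V : Type} [Fintype V] [DecidableEq V] (G : SimpleGraph V) (b t : V)
    (hab : AlmostBipartite G b t) :
    sInf {n : ℕ | ∃ S : Set V, b ∈ S ∧ t ∉ S ∧ n = uncutCount G S}
      = sSup {n : ℕ | ∃ f : Fin n → SpecialPiece G b t,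
          ∀ a c : Fin n, a ≠ c →
            ∀ e : Sym2 V, e ∈ (f a).walk.edges → e ∉ (f c).walk.edges} := by
  obtain ⟨hbt, C, hC⟩ := hab
  set D : Set V := {v | v ∉ C ∧ v ≠ b ∧ v ≠ t} with hDdef
  have hb : b ∉ D := by simp [hDdef]
  have ht : t ∉ D := by simp [hDdef]
  have hD : ∀ ⦃u v : V⦄, G.Adj u v → u ≠ b → u ≠ t → v ≠ b → v ≠ t → (u ∈ D ↔ v ∉ D) := by
    intro u v h h1 h2 h3 h4
    have := hC h h1 h2 h3 h4
    simp only [hDdef, Set.mem_ofPred_eq]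
    tauto
  obtain ⟨k, P, S, hdis, hbS, htS, hk⟩ :=
    (twistGraph G b t D).exists_edgeDisjoint_paths_and_cut hbt
  obtain ⟨S', hbS', htS', hle⟩ := exists_uncutCount_le_of_twisted_cut hb ht hD hbS htS
  rw [hk] at hle
  choose q hq using fun i => exists_specialPiece_of_twisted_path hb ht hbt hD (P i)
  have hqdis : ∀ a c : Fin k, a ≠ c →
      ∀ e : Sym2 V, e ∈ (q a).walk.edges → e ∉ (q c).walk.edges := by
    intro a c hac e ha hc
    obtain ⟨e₁, h₁, he₁⟩ := hq a e ha
    obtain ⟨e₂, h₂, he₂⟩ := hq c e hc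
    have : e₁ = e₂ := twistEdge_injective hb ht (he₁.trans he₂.symm)
    exact hdis a c hac e₁ h₁ (this ▸ h₂)
  apply le_antisymm
  · have hinf : sInf {n : ℕ | ∃ S : Set V, b ∈ S ∧ t ∉ S ∧ n = uncutCount G S} ≤
        uncutCount G S' := Nat.sInf_le ⟨S', hbS', htS', rfl⟩
    refine hinf.trans (hle.trans (le_csSup ?_ ⟨q, hqdis⟩))
    refine ⟨uncutCount G S', ?_⟩
    rintro n ⟨f, hf⟩
    exact card_pieces_le_uncutCount f hf hbS' htS'
  · refine csSup_le ⟨k, q, hqdis⟩ ?_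
    rintro n ⟨f, hf⟩
    refine le_csInf ⟨_, S', hbS', htS', rfl⟩ ?_
    rintro m ⟨U, hbU, htU, rfl⟩
    exact card_pieces_le_uncutCount f hf hbU htU
end
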